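/- arXiv:2107.07070 — 2 statements merged into one kernel-verified Lean document; each statement's English description precedes it below -/
import Mathlib

section
/- Let (u, N, p) be a classical solution of the damped Navier–Stokes–Bardina equations with initial datum u₀ and zero force (f = 0). Then for every exponent q with 2 ≤ q < ∞ there exist a constant C > 0 (depending on u₀, q, α, β, ν) and a time t₀ ≥ 1 such that for all t ≥ t₀: ( ∫_{ℝ³} |u(t,x)|^q dx )^{1/q} ≤ C e^{−(2β/q) t}. -/
open MeasureTheory Set

noncomputable section

abbrev V3 : Type := Fin 3 → ℝ

def pd (j : Fin 3) (g : V3 → Fin 3 → ℝ) : V3 → Fin 3 → ℝ :=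
  fun x => fderiv ℝ g x (Pi.single j 1)

def pdS (j : Fin 3) (g : V3 → ℝ) : V3 → ℝ :=
  fun x => fderiv ℝ g x (Pi.single j 1)

def L2sq (g : V3 → Fin 3 → ℝ) : ℝ := ∫ x : V3, ∑ i, (g x i)^2
def H1sq (g : V3 → Fin 3 → ℝ) : ℝ := ∫ x : V3, ∑ i, ∑ j, (pd j g x i)^2
def H2sq (g : V3 → Fin 3 → ℝ) : ℝ := ∫ x : V3, ∑ i, ∑ j, ∑ k, (pd k (pd j g) x i)^2
def H1aSq (α : ℝ) (g : V3 → Fin 3 → ℝ) : ℝ := L2sq g + α^2 * H1sq g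

def IsSchwartz {F : Type*} [NormedAddCommGroup F] [NormedSpace ℝ F] (g : V3 → F) : Prop :=
  ContDiff ℝ (⊤ : ℕ∞) g ∧ ∀ (k n : ℕ), ∃ C : ℝ, ∀ x : V3, ‖x‖ ^ k * ‖iteratedFDeriv ℝ n g x‖ ≤ C

def IsForce (f : V3 → Fin 3 → ℝ) : Prop :=
  IsSchwartz f ∧ ∀ x, (∑ j, pd j f x j) = 0

def SchwartzLocBdd {F : Type*} [NormedAddCommGroup F] [NormedSpace ℝ F]
    (g : ℝ → V3 → F) : Prop :=
  ContDiffOn ℝ (⊤ : ℕ∞) (fun q : ℝ × V3 => g q.1 q.2) (Set.Ici (0:ℝ) ×ˢ Set.univ) ∧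
  ∀ T > (0:ℝ), ∀ (k n : ℕ), ∃ C : ℝ, ∀ t ∈ Set.Icc (0:ℝ) T, ∀ x : V3,
    ‖x‖ ^ k * ‖iteratedFDeriv ℝ n (g t) x‖ ≤ C

structure ClassicalSolution (α β ν : ℝ) (u₀ f : V3 → Fin 3 → ℝ) where
  u : ℝ → V3 → Fin 3 → ℝ
  N : ℝ → V3 → Fin 3 → ℝ
  p : ℝ → V3 → ℝ
  reg_u : SchwartzLocBdd u
  reg_N : SchwartzLocBdd N
  reg_p : SchwartzLocBdd p
  divFree : ∀ t ≥ (0:ℝ), ∀ x, (∑ j, pd j (u t) x j) = 0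
  filter : ∀ t ≥ (0:ℝ), ∀ x i, -α^2 * (∑ j, pd j (pd j (N t)) x i) + N t x i
      = ∑ j, u t x j * pd j (u t) x i
  momentum : ∀ t ≥ (0:ℝ), ∀ x i,
      derivWithin (fun s => u s x i) (Set.Ici (0:ℝ)) t + N t x i
        - ν * (∑ j, pd j (pd j (u t)) x i) + pdS i (p t) x
      = f x i - β * u t x i
  init : ∀ x, u 0 x = u₀ x

open scoped SchwartzMap LineDeriv FourierTransform

namespace SchwartzMap

section Sobolev

abbrev E3 : Type := EuclideanSpace ℝ (Fin 3)

/-- The standard basis of `E3`. -/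
abbrev eE (j : Fin 3) : E3 := EuclideanSpace.single j 1

/-- The standard basis of `V3`. -/
abbrev eV (j : Fin 3) : V3 := Pi.single j 1

theorem integral_mul_sq_le {X : Type*} [MeasurableSpace X] {μ : Measure X} {f g : X → ℝ}
    (hf0 : 0 ≤ f) (hg0 : 0 ≤ g) (hf : MemLp f 2 μ) (hg : MemLp g 2 μ) :
    (∫ x, f x * g x ∂μ) ^ 2 ≤ (∫ x, f x ^ 2 ∂μ) * ∫ x, g x ^ 2 ∂μ := by
  have h := integral_mul_le_Lp_mul_Lq_of_nonneg (μ := μ) (p := 2) (q := 2)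
    Real.HolderConjugate.two_two (Filter.Eventually.of_forall hf0)
    (Filter.Eventually.of_forall hg0) (by simpa using hf) (by simpa using hg)
  simp only [Real.rpow_ofNat, ← Real.sqrt_eq_rpow] at h
  have h0 : 0 ≤ ∫ x, f x * g x ∂μ := integral_nonneg fun x => mul_nonneg (hf0 x) (hg0 x)
  calc (∫ x, f x * g x ∂μ) ^ 2 ≤ _ := pow_le_pow_left₀ h0 h 2
    _ = _ := by
      rw [mul_pow, Real.sq_sqrt (integral_nonneg fun x => sq_nonneg _),
        Real.sq_sqrt (integral_nonneg fun x => sq_nonneg _)]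

theorem norm_apply_le_integral_norm_fourier (g : 𝓢(E3, ℂ)) (x : E3) :
    ‖g x‖ ≤ ∫ ξ, ‖𝓕 g ξ‖ := by
  have h : g x = 𝓕⁻ (𝓕 g) x := by simp
  rw [h, fourierInv_coe, Real.fourierInv_eq']
  refine (norm_integral_le_integral_norm _).trans (le_of_eq ?_)
  congr 1 with ξ
  rw [norm_smul, Complex.norm_exp_ofReal_mul_I, one_mul]

theorem fourier_helmholtz (g : 𝓢(E3, ℂ)) (ξ : E3) :
    𝓕 (g - ∑ j : Fin 3, ∂_{eE j} (∂_{eE j} g)) ξ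
      = ((1 + (2 * Real.pi) ^ 2 * ‖ξ‖ ^ 2 : ℝ) : ℂ) * 𝓕 g ξ := by
  have ht (j : Fin 3) : (fun x : E3 => inner ℝ x (eE j)).HasTemperateGrowth := by
    fun_prop
  have h1 (j : Fin 3) : 𝓕 (∂_{eE j}
      (∂_{eE j} g)) ξ = -((2 * Real.pi) ^ 2 * (ξ j) ^ 2 : ℝ) * 𝓕 g ξ := by
    rw [fourier_lineDerivOp_eq, fourier_lineDerivOp_eq]
    simp only [smul_apply, smulLeftCLM_apply_apply (ht j)]
    simp [EuclideanSpace.inner_single_right]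
    linear_combination (4 * (Real.pi:ℂ)^2 * (ξ j)^2 * 𝓕 g ξ) * Complex.I_sq
  have h2 : 𝓕 (g - ∑ j : Fin 3, ∂_{eE j} (∂_{eE j} g))
      = 𝓕 g - ∑ j : Fin 3, 𝓕 (∂_{eE j} (∂_{eE j} g)) := by
    change fourierTransformCLM ℂ _ = fourierTransformCLM ℂ _ - ∑ j : Fin 3, fourierTransformCLM ℂ _
    rw [map_sub, map_sum]
  rw [h2]
  simp only [Fin.sum_univ_three, EuclideanSpace.norm_sq_eq, Real.norm_eq_abs, sq_abs, sub_apply,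
    add_apply, h1]
  push_cast
  ring

theorem exists_norm_sq_le_helmholtz : ∃ C > (0 : ℝ), ∀ (g : 𝓢(E3, ℂ)) (x : E3),
    ‖g x‖ ^ 2 ≤ C * ∫ y, ‖(g - ∑ j : Fin 3, ∂_{eE j}
      (∂_{eE j} g)) y‖ ^ 2 := by
  set w : E3 → ℝ := fun ξ => (1 + (2 * Real.pi) ^ 2 * ‖ξ‖ ^ 2)⁻¹ with hw
  have hw0 : 0 ≤ w := fun ξ => by simp only [hw, Pi.zero_apply]; positivity
  have hwc : Continuous w := by
    refine Continuous.inv₀ (by fun_prop) fun ξ => by positivity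
  have hw2 : Integrable fun ξ => w ξ ^ 2 := by
    have := integrable_rpow_neg_one_add_norm_sq (E := E3) (μ := volume) (r := 4) (by simp; norm_num)
    refine this.mono' (by fun_prop) (Filter.Eventually.of_forall fun ξ => ?_)
    have h1 : ((1 : ℝ) + ‖ξ‖ ^ 2) ^ (-(4 : ℝ) / 2) = ((1 + ‖ξ‖ ^ 2) ^ 2)⁻¹ := by
      rw [show (-(4 : ℝ) / 2) = -(2 : ℕ) by norm_num, Real.rpow_neg (by positivity),
        Real.rpow_natCast]
    rw [h1, Real.norm_eq_abs, abs_of_nonneg (sq_nonneg _), hw, inv_pow]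
    gcongr
    have : (1 : ℝ) ≤ (2 * Real.pi) ^ 2 := by nlinarith [Real.pi_gt_three]
    nlinarith [sq_nonneg ‖ξ‖]
  have hwm : MemLp w 2 := (memLp_two_iff_integrable_sq hwc.aestronglyMeasurable).2 hw2
  refine ⟨(∫ ξ, w ξ ^ 2) + 1, by positivity, fun g x => ?_⟩
  set h := g - ∑ j : Fin 3, ∂_{eE j} (∂_{eE j} g) with hh
  have hF (ξ : E3) : ‖𝓕 g ξ‖ = w ξ * ‖𝓕 h ξ‖ := by
    rw [hh, fourier_helmholtz, norm_mul, Complex.norm_real, Real.norm_of_nonneg (by positivity),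
      ← mul_assoc, hw, inv_mul_cancel₀ (by positivity), one_mul]
  have hm : MemLp (fun ξ => ‖𝓕 h ξ‖) 2 := ((𝓕 h).memLp 2).norm
  calc ‖g x‖ ^ 2 ≤ (∫ ξ, w ξ * ‖𝓕 h ξ‖) ^ 2 := by
        simp_rw [← hF]
        exact pow_le_pow_left₀ (norm_nonneg _) (norm_apply_le_integral_norm_fourier g x) 2
    _ ≤ (∫ ξ, w ξ ^ 2) * ∫ ξ, ‖𝓕 h ξ‖ ^ 2 := integral_mul_sq_le hw0 (fun _ => norm_nonneg _) hwm hm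
    _ ≤ _ := by
      rw [integral_norm_sq_fourier]
      gcongr
      linarith

theorem exists_sq_apply_le_helmholtz : ∃ C > (0 : ℝ), ∀ (f : 𝓢(V3, ℝ)) (x : V3),
    f x ^ 2 ≤ C * ∫ y, ((f - ∑ j : Fin 3, ∂_{eV j} (∂_{eV j} f)) y) ^ 2 := by
  obtain ⟨C, hC, H⟩ := exists_norm_sq_le_helmholtz
  refine ⟨C, hC, fun f x => ?_⟩
  set e : E3 ≃L[ℝ] V3 := EuclideanSpace.equiv (Fin 3) ℝ
  set T : 𝓢(V3, ℝ) → 𝓢(E3, ℂ) := fun f =>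
    postcompCLM Complex.ofRealCLM (compCLMOfContinuousLinearEquiv ℝ e f) with hT
  have hTa (f : 𝓢(V3, ℝ)) (y : E3) : T f y = (f (e y) : ℂ) := by simp [hT]
  have hTd (f : 𝓢(V3, ℝ)) (j : Fin 3) : ∂_{eE j} (T f) = T (∂_{eV j} f) := by
    ext y
    have h2 : HasFDerivAt (T f)
        (Complex.ofRealCLM ∘L (fderiv ℝ f (e y)) ∘L (e : E3 →L[ℝ] V3)) y := by
      have h3 := (f.hasFDerivAt (e y)).comp y e.hasFDerivAt
      have h4 := (Complex.ofRealCLM.hasFDerivAt (x := f (e y))).comp y h3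
      exact h4.congr_of_eventuallyEq (Filter.Eventually.of_forall fun z => hTa f z)
    rw [lineDerivOp_apply_eq_fderiv, h2.fderiv, hTa, lineDerivOp_apply_eq_fderiv]
    have : e (eE j) = eV j := by
      ext i; simp [e, Pi.single_apply]
    simp [this]
  have hmp : MeasurePreserving e volume volume := PiLp.volume_preserving_ofLp (Fin 3)
  have h := H (T f) (e.symm x)
  simp only [hTd] at h
  have h5 : T f - ∑ j : Fin 3, T (∂_{eV j} (∂_{eV j} f)) =
      T (f - ∑ j : Fin 3, ∂_{eV j} (∂_{eV j} f)) := by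
    simp only [hT, map_sub, map_sum]
  rw [h5, hTa, e.apply_symm_apply] at h
  simp only [hTa, Complex.norm_real, Real.norm_eq_abs, sq_abs] at h
  refine h.trans (le_of_eq ?_)
  congr 1
  exact hmp.integral_comp e.toHomeomorph.measurableEmbedding
    (fun z => ((f - ∑ j : Fin 3, ∂_{eV j} (∂_{eV j} f)) z) ^ 2)

end Sobolev

end SchwartzMap

namespace SchwartzMap

section Energy

/-- The partial derivative `∂ⱼ` on scalar Schwartz functions. -/
def dS (j : Fin 3) : 𝓢(V3, ℝ) →L[ℝ] 𝓢(V3, ℝ) := LineDeriv.lineDerivOpCLM ℝ 𝓢(V3, ℝ) (eV j)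

/-- The pointwise product of Schwartz functions. -/
def mulS : 𝓢(V3, ℝ) →ₗ[ℝ] 𝓢(V3, ℝ) →L[ℝ] 𝓢(V3, ℝ) := pairing (ContinuousLinearMap.mul ℝ ℝ)

/-- The `L²` inner product as a bilinear form. -/
def ip : 𝓢(V3, ℝ) →ₗ[ℝ] 𝓢(V3, ℝ) →ₗ[ℝ] ℝ :=
  LinearMap.mk₂ ℝ (fun f g => integralCLM ℝ volume (mulS f g))
    (fun _ _ _ => by rw [map_add, _root_.add_apply, map_add])
    (fun _ _ _ => by rw [map_smul, _root_.smul_apply, map_smul])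
    (fun _ _ _ => by rw [map_add, map_add]) (fun _ _ _ => by rw [map_smul, map_smul])

/-- The Laplacian on scalar Schwartz functions. -/
def lapS : 𝓢(V3, ℝ) →L[ℝ] 𝓢(V3, ℝ) := ∑ j, dS j ∘L dS j

/-- The Helmholtz operator `1 - α²Δ`. -/
def helm (α : ℝ) : 𝓢(V3, ℝ) →L[ℝ] 𝓢(V3, ℝ) := ContinuousLinearMap.id ℝ _ - α ^ 2 • lapS

/-- The squared `H¹_α` norm. -/
def en (α : ℝ) (f : 𝓢(V3, ℝ)) : ℝ := ip f f + α ^ 2 * ∑ k, ip (dS k f) (dS k f)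

theorem dS_apply (j : Fin 3) (f : 𝓢(V3, ℝ)) (x : V3) : dS j f x = fderiv ℝ f x (eV j) := rfl

@[simp] theorem mulS_apply (f g : 𝓢(V3, ℝ)) (x : V3) : mulS f g x = f x * g x := rfl

theorem ip_apply (f g : 𝓢(V3, ℝ)) : ip f g = ∫ x, f x * g x := rfl

theorem lapS_apply (f : 𝓢(V3, ℝ)) : lapS f = ∑ j, dS j (dS j f) := by
  simp [lapS]

theorem helm_apply (α : ℝ) (f : 𝓢(V3, ℝ)) : helm α f = f - α ^ 2 • lapS f := rfl

theorem integrable_mul (f g : 𝓢(V3, ℝ)) : Integrable fun x => f x * g x := (mulS f g).integrable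

theorem ip_comm (f g : 𝓢(V3, ℝ)) : ip f g = ip g f := by
  simp only [ip_apply, mul_comm]

theorem ip_self_nonneg (f : 𝓢(V3, ℝ)) : 0 ≤ ip f f :=
  integral_nonneg fun x => mul_self_nonneg (f x)

theorem ip_mulS_left (f g h : 𝓢(V3, ℝ)) : ip (mulS f g) h = ip f (mulS g h) := by
  simp only [ip_apply, mulS_apply, mul_assoc]

theorem ip_dS_left (j : Fin 3) (f g : 𝓢(V3, ℝ)) : ip (dS j f) g = -ip f (dS j g) := by
  have h := integral_mul_lineDerivOp_right_eq_neg_left (μ := volume) f g (eV j)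
  change ip f (dS j g) = -ip (dS j f) g at h
  rw [h, neg_neg]

theorem dS_comm (i j : Fin 3) (f : 𝓢(V3, ℝ)) : dS i (dS j f) = dS j (dS i f) := by
  ext x
  have h (i j : Fin 3) : dS i (dS j f) x = fderiv ℝ (fderiv ℝ f) x (eV i) (eV j) := by
    rw [dS_apply]
    have h1 : HasFDerivAt (fderiv ℝ f) (fderiv ℝ (fderiv ℝ f) x) x :=
      (((f.smooth 2).fderiv_right (m := 1) (by norm_num)).differentiable
        (by norm_num) x).hasFDerivAt
    have h2 := (h1.clm_apply (hasFDerivAt_const (eV j) x)).fderiv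
    change fderiv ℝ (fun y => fderiv ℝ f y (eV j)) x (eV i) = _
    rw [h2]
    simp
  rw [h, h]
  exact ((f.contDiffAt 2).isSymmSndFDerivAt (by simp)).eq _ _

theorem dS_mulS (j : Fin 3) (f g : 𝓢(V3, ℝ)) :
    dS j (mulS f g) = mulS (dS j f) g + mulS f (dS j g) := by
  ext x
  have h := ((f.hasFDerivAt x).mul (g.hasFDerivAt x)).fderiv
  rw [dS_apply]
  change fderiv ℝ (⇑f * ⇑g) x (eV j) = _
  rw [h]
  simp [dS_apply]
  ring

theorem ip_sq_le (f g : 𝓢(V3, ℝ)) : ip f g ^ 2 ≤ ip f f * ip g g := by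
  have h (t : ℝ) : 0 ≤ ip g g * (t * t) + 2 * ip f g * t + ip f f := by
    have := ip_self_nonneg (f + t • g)
    simp only [map_add, LinearMap.add_apply, map_smul, LinearMap.smul_apply, smul_eq_mul,
      ip_comm g f] at this
    linarith
  have := discrim_le_zero h
  rw [discrim] at this
  linarith

theorem ip_mulS_sq_le {B : ℝ} (h f g : 𝓢(V3, ℝ)) (hB : ∀ x, h x ^ 2 ≤ B) :
    ip (mulS h f) g ^ 2 ≤ B * ip f f * ip g g := by
  refine (ip_sq_le _ _).trans (mul_le_mul_of_nonneg_right ?_ (ip_self_nonneg g))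
  rw [ip_apply, ip_apply, ← integral_const_mul]
  refine integral_mono (integrable_mul _ _) ((integrable_mul _ _).const_mul _) fun x => ?_
  simp only [mulS_apply]
  nlinarith [mul_le_mul_of_nonneg_right (hB x) (sq_nonneg (f x))]

theorem dS_lapS (j : Fin 3) (f : 𝓢(V3, ℝ)) : dS j (lapS f) = lapS (dS j f) := by
  simp only [lapS_apply, map_sum]
  exact Finset.sum_congr rfl fun k _ => by rw [dS_comm j k, dS_comm j k]

theorem dS_helm (α : ℝ) (j : Fin 3) (f : 𝓢(V3, ℝ)) : dS j (helm α f) = helm α (dS j f) := by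
  simp only [helm_apply, map_sub, map_smul, dS_lapS]

theorem ip_lapS (f g : 𝓢(V3, ℝ)) : ip (lapS f) g = -∑ k, ip (dS k f) (dS k g) := by
  simp only [lapS_apply, map_sum, LinearMap.sum_apply, ip_dS_left _ (dS _ f),
    Finset.sum_neg_distrib]

theorem ip_helm (α : ℝ) (f g : 𝓢(V3, ℝ)) :
    ip f (helm α g) = ip f g + α ^ 2 * ∑ k, ip (dS k f) (dS k g) := by
  rw [helm_apply, map_sub, map_smul, ip_comm f (lapS g), ip_lapS]
  simp only [ip_comm (dS _ g), smul_eq_mul]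
  ring

theorem ip_helm_left (α : ℝ) (f g : 𝓢(V3, ℝ)) : ip (helm α f) g = ip f (helm α g) := by
  rw [ip_comm, ip_helm, ip_helm]
  simp only [ip_comm]

theorem en_eq (α : ℝ) (f : 𝓢(V3, ℝ)) : en α f = ip f (helm α f) := (ip_helm α f f).symm

theorem en_nonneg (α : ℝ) (f : 𝓢(V3, ℝ)) : 0 ≤ en α f :=
  add_nonneg (ip_self_nonneg f)
    (mul_nonneg (sq_nonneg α) (Finset.sum_nonneg fun _ _ => ip_self_nonneg _))

theorem ip_dS_le {α : ℝ} (hα : 0 < α) (j : Fin 3) (f : 𝓢(V3, ℝ)) :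
    ip (dS j f) (dS j f) ≤ (α ^ 2)⁻¹ * en α f := by
  have h : ip (dS j f) (dS j f) ≤ ∑ k, ip (dS k f) (dS k f) :=
    Finset.single_le_sum (f := fun k => ip (dS k f) (dS k f)) (fun _ _ => ip_self_nonneg _)
      (Finset.mem_univ j)
  rw [le_inv_mul_iff₀ (by positivity)]
  exact (mul_le_mul_of_nonneg_left h (sq_nonneg α)).trans
    (le_add_of_nonneg_left (ip_self_nonneg f))

theorem ip_lapS_helm (α : ℝ) (f : 𝓢(V3, ℝ)) : ip (lapS f) (helm α f) = -∑ k, en α (dS k f) := by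
  simp only [ip_lapS, dS_helm, en_eq]

/-- The energy balance for the spatial part of the equations. -/
theorem sum_ip_helm (α β ν : ℝ) (u n W : Fin 3 → 𝓢(V3, ℝ)) (p : 𝓢(V3, ℝ))
    (hdiv : ∑ i, dS i (u i) = 0)
    (hW : ∀ i, W i = -n i + ν • lapS (u i) - dS i p - β • u i) :
    ∑ i, ip (W i) (helm α (u i)) = -∑ i, ip (helm α (n i)) (u i)
      - ν * ∑ k, ∑ i, en α (dS k (u i)) - β * ∑ i, en α (u i) := by
  have h (i : Fin 3) : ip (W i) (helm α (u i)) = -ip (helm α (n i)) (u i)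
      - ν * ∑ k, en α (dS k (u i)) - β * en α (u i) + ip p (helm α (dS i (u i))) := by
    rw [hW]
    simp only [map_sub, map_add, map_neg, map_smul, LinearMap.sub_apply, LinearMap.add_apply,
      LinearMap.neg_apply, LinearMap.smul_apply, smul_eq_mul, ip_lapS_helm, ip_helm_left,
      ip_dS_left, dS_helm, ← en_eq]
    ring
  have hp : ∑ i, ip p (helm α (dS i (u i))) = 0 := by
    rw [← map_sum, ← map_sum, hdiv, map_zero, map_zero]
  rw [Finset.sum_comm (f := fun k i => en α (dS k (u i)))]
  simp only [h, Finset.sum_add_distrib, Finset.sum_sub_distrib, Finset.sum_neg_distrib,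
    ← Finset.mul_sum, hp, add_zero]

/-- The convective term `(u·∇)v`. -/
def adv (u : Fin 3 → 𝓢(V3, ℝ)) (v : 𝓢(V3, ℝ)) : 𝓢(V3, ℝ) := ∑ j, mulS (u j) (dS j v)

theorem ip_adv_self (u : Fin 3 → 𝓢(V3, ℝ)) (v : 𝓢(V3, ℝ)) (hdiv : ∑ i, dS i (u i) = 0) :
    ip (adv u v) v = 0 := by
  have h (j : Fin 3) : ip (mulS (u j) (dS j v)) v = -(1 / 2) * ip (dS j (u j)) (mulS v v) := by
    have hc : mulS v (dS j v) = mulS (dS j v) v := by ext x; simp [mul_comm]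
    rw [ip_mulS_left, ip_dS_left, dS_mulS, map_add, hc]
    ring
  rw [adv, map_sum, LinearMap.sum_apply]
  simp only [h]
  rw [← Finset.mul_sum, ← LinearMap.sum_apply, ← map_sum, hdiv, map_zero, LinearMap.zero_apply,
    mul_zero]

theorem exists_sq_apply_le_en {α : ℝ} (hα : 0 < α) : ∃ C > (0 : ℝ), ∀ (f : 𝓢(V3, ℝ)) (x : V3),
    f x ^ 2 ≤ C * (en α f + ∑ k, en α (dS k f)) := by
  obtain ⟨C, hC, H⟩ := exists_sq_apply_le_helmholtz
  refine ⟨C * (4 * (1 + (α ^ 2)⁻¹)), by positivity, fun f x => (H f x).trans ?_⟩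
  rw [mul_assoc]
  refine mul_le_mul_of_nonneg_left ?_ hC.le
  have h0 : ∫ y, ((f - ∑ j, ∂_{eV j} (∂_{eV j} f)) y) ^ 2
      ≤ 4 * (ip f f + ∑ j, ip (dS j (dS j f)) (dS j (dS j f))) := by
    have hi : ∑ j, ip (dS j (dS j f)) (dS j (dS j f))
        = ∫ y, ∑ j, dS j (dS j f) y * dS j (dS j f) y :=
      (integral_finsetSum _ fun j _ => integrable_mul _ _).symm
    rw [hi, ip_apply, ← integral_add (integrable_mul _ _)
      (integrable_finsetSum _ fun j _ => integrable_mul _ _), ← integral_const_mul]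
    refine integral_mono ?_ (((integrable_mul _ _).add
      (integrable_finsetSum _ fun j _ => integrable_mul _ _)).const_mul _) fun y => ?_
    · simpa only [sq] using integrable_mul (f - ∑ j, ∂_{eV j} (∂_{eV j} f)) _
    · change (f - ∑ j, dS j (dS j f)) y ^ 2 ≤ _
      simp only [Fin.sum_univ_three, sub_apply, add_apply]
      set a := f y
      set b := dS 0 (dS 0 f) y
      set c := dS 1 (dS 1 f) y
      set d := dS 2 (dS 2 f) y
      nlinarith [sq_nonneg (a + b), sq_nonneg (a + c), sq_nonneg (a + d), sq_nonneg (b - c),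
        sq_nonneg (b - d), sq_nonneg (c - d)]
  have h1 : ip f f ≤ en α f := le_add_of_nonneg_right
    (mul_nonneg (sq_nonneg α) (Finset.sum_nonneg fun _ _ => ip_self_nonneg _))
  have h2 (j : Fin 3) : ip (dS j (dS j f)) (dS j (dS j f)) ≤ (α ^ 2)⁻¹ * en α (dS j f) := by
    exact ip_dS_le hα j _
  have h3 := Finset.sum_le_sum fun j (_ : j ∈ Finset.univ) => h2 j
  rw [← Finset.mul_sum] at h3
  have h4 : 0 ≤ ∑ k, en α (dS k f) := Finset.sum_nonneg fun _ _ => en_nonneg _ _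
  have h5 : 0 ≤ (α ^ 2)⁻¹ * en α f := mul_nonneg (by positivity) (en_nonneg _ _)
  linarith

/-- The convective term is controlled by the energies of `u` and of its gradient. -/
theorem exists_abs_sum_ip_adv_le {α : ℝ} (hα : 0 < α) : ∃ K > (0 : ℝ), ∀ u : Fin 3 → 𝓢(V3, ℝ),
    |∑ k, ∑ i, ip (dS k (adv u (u i))) (dS k (u i))| ≤ K * √(∑ i, en α (u i)) *
      (∑ i, en α (u i) + ∑ k, ∑ i, en α (dS k (u i))) := by
  obtain ⟨C, hC, H⟩ := exists_sq_apply_le_en hα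
  refine ⟨27 * √(C * ((α ^ 2)⁻¹) ^ 2), by positivity, fun u => ?_⟩
  set E := ∑ i, en α (u i) with hE
  set F := ∑ k, ∑ i, en α (dS k (u i)) with hF
  have hEi (i : Fin 3) : en α (u i) ≤ E :=
    Finset.single_le_sum (f := fun i => en α (u i)) (fun _ _ => en_nonneg _ _) (Finset.mem_univ i)
  have hFk (k : Fin 3) : ∑ i, en α (dS k (u i)) ≤ F :=
    Finset.single_le_sum (f := fun k => ∑ i, en α (dS k (u i)))
      (fun _ _ => Finset.sum_nonneg fun _ _ => en_nonneg _ _) (Finset.mem_univ k)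
  have hFi (i : Fin 3) : ∑ k, en α (dS k (u i)) ≤ F := by
    rw [hF, Finset.sum_comm]
    exact Finset.single_le_sum (f := fun i => ∑ k, en α (dS k (u i)))
      (fun _ _ => Finset.sum_nonneg fun _ _ => en_nonneg _ _) (Finset.mem_univ i)
  have hFki (k i : Fin 3) : en α (dS k (u i)) ≤ F :=
    (Finset.single_le_sum (f := fun i => en α (dS k (u i))) (fun _ _ => en_nonneg _ _)
      (Finset.mem_univ i)).trans (hFk k)
  have hE0 : 0 ≤ E := (en_nonneg α _).trans (hEi 0)
  have hF0 : 0 ≤ F := (en_nonneg α _).trans (hFki 0 0)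
  clear_value E F
  have hterm (i j k : Fin 3) : |ip (mulS (u j) (dS j (u i))) (dS k (dS k (u i)))|
      ≤ √(C * ((α ^ 2)⁻¹) ^ 2) * √E * (E + F) := by
    refine abs_le_of_sq_le_sq ?_ (by positivity)
    rw [mul_pow, mul_pow, Real.sq_sqrt (by positivity), Real.sq_sqrt hE0]
    have h1 := ip_mulS_sq_le (B := C * (E + F)) (u j) (dS j (u i)) (dS k (dS k (u i))) fun x =>
      (H (u j) x).trans (mul_le_mul_of_nonneg_left (add_le_add (hEi j) (hFi j)) hC.le)
    have h2 : ip (dS j (u i)) (dS j (u i)) ≤ (α ^ 2)⁻¹ * E :=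
      (ip_dS_le hα j _).trans (mul_le_mul_of_nonneg_left (hEi i) (by positivity))
    have h3 : ip (dS k (dS k (u i))) (dS k (dS k (u i))) ≤ (α ^ 2)⁻¹ * (E + F) :=
      (ip_dS_le hα k _).trans (mul_le_mul_of_nonneg_left
        ((hFki k i).trans (le_add_of_nonneg_left hE0)) (by positivity))
    calc _ ≤ _ := h1
      _ ≤ C * (E + F) * ((α ^ 2)⁻¹ * E) * ((α ^ 2)⁻¹ * (E + F)) := by
        gcongr
        exact ip_self_nonneg _
      _ = _ := by ring
  have hs : ∑ k, ∑ i, ip (dS k (adv u (u i))) (dS k (u i))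
      = -∑ k, ∑ i, ∑ j, ip (mulS (u j) (dS j (u i))) (dS k (dS k (u i))) := by
    simp only [ip_dS_left, adv, map_sum, LinearMap.sum_apply, Finset.sum_neg_distrib]
  rw [hs, abs_neg]
  refine (Finset.abs_sum_le_sum_abs _ _).trans <| (Finset.sum_le_sum fun k _ =>
    (Finset.abs_sum_le_sum_abs _ _).trans <| Finset.sum_le_sum fun i _ =>
    (Finset.abs_sum_le_sum_abs _ _).trans <| Finset.sum_le_sum fun j _ => hterm i j k).trans
      (le_of_eq ?_)
  simp
  ring

end Energy

end SchwartzMap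

namespace SchwartzMap

section Evolution

open Bornology

/-- `W` is the time derivative of the family `U` of Schwartz functions on `(0, ∞)`, with `U` jointly
smooth and both families locally bounded in the Schwartz space. -/
structure Evol (U W : ℝ → 𝓢(V3, ℝ)) : Prop where
  smooth : ContDiffOn ℝ (⊤ : ℕ∞) (fun q : ℝ × V3 => U q.1 q.2) (Ioi 0 ×ˢ univ)
  bdd : ∀ T, IsVonNBounded ℝ (U '' Ioc 0 T)
  bdd_deriv : ∀ T, IsVonNBounded ℝ (W '' Ioc 0 T)
  hasDerivAt : ∀ t > 0, ∀ x, HasDerivAt (fun s => U s x) (W t x) t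

theorem isOpen_halfSpace : IsOpen (Ioi (0 : ℝ) ×ˢ (univ : Set V3)) := isOpen_Ioi.prod isOpen_univ

theorem hasFDerivAt_of_smooth {U : ℝ → 𝓢(V3, ℝ)}
    (hU : ContDiffOn ℝ (⊤ : ℕ∞) (fun q : ℝ × V3 => U q.1 q.2) (Ioi 0 ×ˢ univ))
    {q : ℝ × V3} (hq : 0 < q.1) :
    HasFDerivAt (fun q : ℝ × V3 => U q.1 q.2) (fderiv ℝ (fun q : ℝ × V3 => U q.1 q.2) q) q :=
  ((hU.contDiffAt (isOpen_halfSpace.mem_nhds ⟨hq, mem_univ _⟩)).differentiableAt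
    (by simp)).hasFDerivAt

theorem fderiv_uncurry_space {U : ℝ → 𝓢(V3, ℝ)}
    (hU : ContDiffOn ℝ (⊤ : ℕ∞) (fun q : ℝ × V3 => U q.1 q.2) (Ioi 0 ×ˢ univ))
    {q : ℝ × V3} (hq : 0 < q.1) (j : Fin 3) :
    fderiv ℝ (fun q : ℝ × V3 => U q.1 q.2) q (0, eV j) = dS j (U q.1) q.2 := by
  have h := HasFDerivAt.comp (f := fun y : V3 => (q.1, y)) q.2 (hasFDerivAt_of_smooth hU hq)
    (hasFDerivAt_prodMk_right (𝕜 := ℝ) q.1 q.2)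
  rw [dS_apply]
  change _ = fderiv ℝ ((fun q : ℝ × V3 => U q.1 q.2) ∘ fun y => (q.1, y)) q.2 (eV j)
  rw [h.fderiv]
  simp

theorem hasDerivAt_of_smooth {U : ℝ → 𝓢(V3, ℝ)}
    (hU : ContDiffOn ℝ (⊤ : ℕ∞) (fun q : ℝ × V3 => U q.1 q.2) (Ioi 0 ×ˢ univ))
    {q : ℝ × V3} (hq : 0 < q.1) :
    HasDerivAt (fun s => U s q.2) (fderiv ℝ (fun q : ℝ × V3 => U q.1 q.2) q (1, 0)) q.1 := by
  have h := HasFDerivAt.comp (f := fun s : ℝ => (s, q.2)) q.1 (hasFDerivAt_of_smooth hU hq)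
    (hasFDerivAt_prodMk_left (𝕜 := ℝ) q.1 q.2)
  exact h.hasDerivAt.congr_deriv (by simp)

theorem Evol.dS {U W : ℝ → 𝓢(V3, ℝ)} (h : Evol U W) (j : Fin 3) :
    Evol (fun t => dS j (U t)) (fun t => dS j (W t)) := by
  set Φ : ℝ × V3 → ℝ := fun q => U q.1 q.2 with hΦ
  have himg (V : ℝ → 𝓢(V3, ℝ)) (s : Set ℝ) :
      (fun t => SchwartzMap.dS j (V t)) '' s = SchwartzMap.dS j '' (V '' s) :=
    (image_image _ _ _).symm
  refine ⟨?_, fun T => ?_, fun T => ?_, fun t ht x => ?_⟩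
  · have h1 : ContDiffOn ℝ (⊤ : ℕ∞) (fderiv ℝ Φ) (Ioi 0 ×ˢ univ) :=
      h.smooth.fderiv_of_isOpen isOpen_halfSpace (by simp)
    refine (h1.clm_apply (contDiffOn_const (c := ((0 : ℝ), eV j)))).congr fun q hq => ?_
    exact (fderiv_uncurry_space h.smooth hq.1 j).symm
  · rw [himg]; exact (h.bdd T).image _
  · rw [himg]; exact (h.bdd_deriv T).image _
  · have hc : ContDiffAt ℝ 2 Φ (t, x) :=
      ContDiffAt.of_le (n := ((⊤ : ℕ∞) : WithTop ℕ∞))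
        (h.smooth.contDiffAt (isOpen_halfSpace.mem_nhds (show (t, x) ∈ _ from ⟨ht, mem_univ x⟩)))
        (WithTop.coe_le_coe.2 le_top)
    have hG : HasFDerivAt (fderiv ℝ Φ) (fderiv ℝ (fderiv ℝ Φ) (t, x)) (t, x) :=
      ((hc.fderiv_right (m := 1) (by norm_num)).differentiableAt
        (by norm_num)).hasFDerivAt
    have hsymm := hc.isSymmSndFDerivAt (by simp)
    have h1 : HasDerivAt (fun s => fderiv ℝ Φ (s, x) (0, eV j))
        (fderiv ℝ (fderiv ℝ Φ) (t, x) (1, 0) (0, eV j)) t := by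
      have := ((HasFDerivAt.comp (f := fun s : ℝ => (s, x)) t hG
        (hasFDerivAt_prodMk_left (𝕜 := ℝ) t x)).clm_apply
        (hasFDerivAt_const ((0 : ℝ), eV j) t)).hasDerivAt
      simpa using this
    have h2 : SchwartzMap.dS j (W t) x = fderiv ℝ (fderiv ℝ Φ) (t, x) (0, eV j) (1, 0) := by
      have h3 := ((HasFDerivAt.comp (f := fun y : V3 => (t, y)) x hG
        (hasFDerivAt_prodMk_right (𝕜 := ℝ) t x)).clm_apply
        (hasFDerivAt_const ((1 : ℝ), (0 : V3)) x)).fderiv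
      have h4 : (W t : V3 → ℝ) = fun y => (fderiv ℝ Φ ∘ fun y => (t, y)) y (1, 0) := by
        ext y
        exact (h.hasDerivAt t ht y).unique (hasDerivAt_of_smooth h.smooth (q := (t, y)) ht)
      rw [dS_apply, h4, h3]
      simp
    rw [h2, hsymm.eq]
    refine h1.congr_of_eventuallyEq ?_
    filter_upwards [Ioi_mem_nhds ht] with s hs
    exact (fderiv_uncurry_space h.smooth (q := (s, x)) hs j).symm

theorem exists_bound_of_isVonNBounded {s : Set 𝓢(V3, ℝ)} (hs : IsVonNBounded ℝ s) (k : ℕ) :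
    ∃ C > (0 : ℝ), ∀ f ∈ s, ∀ x, ‖x‖ ^ k * |f x| ≤ C := by
  obtain ⟨C, hC, H⟩ :=
    ((schwartz_withSeminorms ℝ V3 ℝ).isVonNBounded_iff_seminorm_bounded.1 hs) (k, 0)
  exact ⟨C, hC, fun f hf x => (norm_pow_mul_le_seminorm ℝ f k x).trans (H f hf).le⟩

theorem Evol.hasDerivAt_ip {U W : ℝ → 𝓢(V3, ℝ)} (h : Evol U W) {t : ℝ} (ht : 0 < t) :
    HasDerivAt (fun s => ip (U s) (U s)) (2 * ip (W t) (U t)) t := by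
  obtain ⟨A, hA, HA⟩ := exists_bound_of_isVonNBounded (h.bdd_deriv (2 * t)) 0
  obtain ⟨B, hB, HB⟩ := exists_bound_of_isVonNBounded (h.bdd (2 * t)) 0
  obtain ⟨C, hC, HC⟩ := exists_bound_of_isVonNBounded (h.bdd (2 * t)) 4
  have hint : Integrable fun x : V3 => (1 + ‖x‖) ^ (-(4 : ℝ)) :=
    integrable_one_add_norm (by simp; norm_num)
  have hdecay : ∀ s ∈ Ioc 0 (2 * t), ∀ x, |U s x| ≤ 8 * (B + C) * (1 + ‖x‖) ^ (-(4 : ℝ)) := by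
    intro s hs x
    have h0 := HB _ (mem_image_of_mem U hs) x
    have h4 := HC _ (mem_image_of_mem U hs) x
    rw [Real.rpow_neg (by positivity), ← div_eq_mul_inv, le_div_iff₀ (by positivity)]
    rw [show (4 : ℝ) = (4 : ℕ) by norm_num, Real.rpow_natCast]
    have h5 : (1 + ‖x‖) ^ 4 ≤ 8 * (1 + ‖x‖ ^ 4) := by
      nlinarith [sq_nonneg (‖x‖ - 1), sq_nonneg (‖x‖ ^ 2 - 1), sq_nonneg (‖x‖ ^ 2 - ‖x‖),
        sq_nonneg (‖x‖ + 1), norm_nonneg x]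
    nlinarith [mul_le_mul_of_nonneg_left h5 (abs_nonneg (U s x))]
  have hs : Ioo 0 (2 * t) ∈ nhds t := Ioo_mem_nhds ht (by linarith)
  have key := hasDerivAt_integral_of_dominated_loc_of_deriv_le (μ := (volume : Measure V3))
    (F := fun s x => U s x * U s x) (F' := fun s x => W s x * U s x + U s x * W s x)
    (bound := fun x => 2 * A * (8 * (B + C) * (1 + ‖x‖) ^ (-(4 : ℝ)))) hs
    (Filter.Eventually.of_forall fun s => (integrable_mul _ _).aestronglyMeasurable)
    (integrable_mul _ _)
    ((integrable_mul _ _).add (integrable_mul _ _)).aestronglyMeasurable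
    (Filter.Eventually.of_forall fun x s hs => ?_) ((hint.const_mul _).const_mul _)
    (Filter.Eventually.of_forall fun x s hs =>
      (h.hasDerivAt s hs.1 x).mul (h.hasDerivAt s hs.1 x))
  · refine key.2.congr_deriv ?_
    rw [integral_add (integrable_mul _ _) (integrable_mul _ _), ← ip_apply, ← ip_apply,
      ip_comm (U t)]
    ring
  · have h1 := HA _ (mem_image_of_mem W ⟨hs.1, hs.2.le⟩) x
    have h2 := hdecay s ⟨hs.1, hs.2.le⟩ x
    rw [pow_zero, one_mul] at h1
    calc ‖W s x * U s x + U s x * W s x‖ = 2 * (|W s x| * |U s x|) := by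
          rw [← abs_mul, mul_comm (U s x), ← two_mul, Real.norm_eq_abs, abs_mul, abs_two]
      _ ≤ 2 * (A * (8 * (B + C) * (1 + ‖x‖) ^ (-(4 : ℝ)))) := by gcongr
      _ = _ := by ring

theorem Evol.hasDerivAt_en {U W : ℝ → 𝓢(V3, ℝ)} (h : Evol U W) (α : ℝ) {t : ℝ} (ht : 0 < t) :
    HasDerivAt (fun s => en α (U s)) (2 * ip (W t) (helm α (U t))) t := by
  have h1 := (h.hasDerivAt_ip ht).fun_add ((HasDerivAt.fun_sum (u := Finset.univ)
    fun k _ => (h.dS k).hasDerivAt_ip ht).const_mul (α ^ 2))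
  refine h1.congr_deriv ?_
  rw [ip_helm, ← Finset.mul_sum]
  ring

end Evolution

end SchwartzMap

/-- Decay and boundedness for a pair of energies `E`, `F` obeying a Grönwall-type system. -/
theorem energy_decay {β ν K : ℝ} (hβ : 0 < β) (hν : 0 < ν) (hK : 0 < K) {E F F' : ℝ → ℝ}
    (hE0 : ∀ t, 0 ≤ E t) (hF0 : ∀ t, 0 ≤ F t)
    (hE : ∀ t > 0, HasDerivAt E (-(2 * ν) * F t - 2 * β * E t) t)
    (hF : ∀ t > 0, HasDerivAt F (F' t) t)
    (hF' : ∀ t > 0, F' t ≤ 2 * (K * √(E t) * (E t + F t)) - 2 * β * F t) :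
    (∀ t ≥ 1, E t ≤ E 1 * Real.exp (-(2 * β) * (t - 1))) ∧ ∃ M > 0, ∀ t ≥ 1, E t + F t ≤ M := by
  have pos {t : ℝ} (ht : t ∈ Ici (1 : ℝ)) : 0 < t := zero_lt_one.trans_le ht
  have anti {g g' : ℝ → ℝ} (hg : ∀ t > 0, HasDerivAt g (g' t) t) (hg' : ∀ t ≥ 1, g' t ≤ 0) :
      ∀ t ≥ 1, g t ≤ g 1 := by
    have : AntitoneOn g (Ici 1) := antitoneOn_of_deriv_nonpos (convex_Ici 1)
      (fun t ht => (hg t (pos ht)).continuousAt.continuousWithinAt)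
      (fun t ht => (hg t (pos (interior_subset ht))).differentiableAt.differentiableWithinAt)
      (fun t ht => (hg t (pos (interior_subset ht))).deriv.trans_le (hg' t (interior_subset ht)))
    exact fun t ht => this self_mem_Ici ht ht
  have hdec : ∀ t ≥ 1, E t ≤ E 1 * Real.exp (-(2 * β) * (t - 1)) := by
    intro t ht
    have h1 := anti (g := fun s => E s * Real.exp (2 * β * (s - 1)))
      (g' := fun s => (-(2 * ν) * F s - 2 * β * E s) * Real.exp (2 * β * (s - 1)) +
        E s * (Real.exp (2 * β * (s - 1)) * (2 * β * 1)))
      (fun s hs => (hE s hs).mul ((((hasDerivAt_id s).sub_const 1).const_mul (2 * β)).exp))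
      (fun s _ => by
        have := mul_nonneg (mul_nonneg hν.le (hF0 s)) (Real.exp_pos (2 * β * (s - 1))).le
        linarith) t ht
    simp only [sub_self, mul_zero, Real.exp_zero, mul_one] at h1
    rw [neg_mul, Real.exp_neg, ← div_eq_mul_inv]
    exact (le_div_iff₀ (Real.exp_pos _)).2 h1
  have hE1 : ∀ t ≥ 1, E t ≤ E 1 := fun t ht => (hdec t ht).trans <|
    mul_le_of_le_one_right (hE0 1) (Real.exp_le_one_iff.2 (by nlinarith))
  set l := K * √(E 1) * (1 / ν + 1 / β) with hl
  have hs : 0 ≤ K * √(E 1) := by positivity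
  have hlν : K * √(E 1) ≤ l * ν := by
    have : l * ν = K * √(E 1) + K * √(E 1) * (ν / β) := by rw [hl]; field_simp
    rw [this]; exact le_add_of_nonneg_right (by positivity)
  have hlβ : K * √(E 1) ≤ l * β := by
    have : l * β = K * √(E 1) + K * √(E 1) * (β / ν) := by rw [hl]; field_simp; ring
    rw [this]; exact le_add_of_nonneg_right (by positivity)
  have hl0 : 0 ≤ l := by positivity
  have hG := anti (g := fun s => F s + l * E s)
    (fun s hs => (hF s hs).fun_add ((hE s hs).const_mul l)) (fun s hs1 => by
      have hs0 := pos hs1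
      have h1 : K * √(E s) * (E s + F s) ≤ K * √(E 1) * (E s + F s) := by
        have := hE1 s hs1
        have := hE0 s
        have := hF0 s
        gcongr
      have h2 := mul_le_mul_of_nonneg_right hlν (hF0 s)
      have h3 := mul_le_mul_of_nonneg_right hlβ (hE0 s)
      have h4 := mul_nonneg hβ.le (hF0 s)
      linarith [hF' s hs0])
  refine ⟨hdec, E 1 + (F 1 + l * E 1) + 1, ?_, fun t ht => ?_⟩
  · have := hE0 1
    have := hF0 1
    positivity
  · have : F t + l * E t ≤ F 1 + l * E 1 := hG t ht
    have := mul_nonneg hl0 (hE0 t)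
    have := hE1 t ht
    linarith

namespace SchwartzMap

open Bornology

/-- A smooth, locally bounded family of Schwartz functions, bundled as a curve in Schwartz space. -/
theorem exists_bundled {F : Type*} [NormedAddCommGroup F] [NormedSpace ℝ F] {g : ℝ → V3 → F}
    (hg : SchwartzLocBdd g) :
    ∃ G : ℝ → 𝓢(V3, F), (∀ t ≥ 0, ⇑(G t) = g t) ∧
      ContDiffOn ℝ (⊤ : ℕ∞) (fun q : ℝ × V3 => G q.1 q.2) (Ioi 0 ×ˢ univ) ∧
      ∀ T, IsVonNBounded ℝ (G '' Ioc 0 T) := by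
  classical
  obtain ⟨hsmooth, hbdd⟩ := hg
  have hS (t : ℝ) (ht : 0 ≤ t) : ContDiff ℝ (⊤ : ℕ∞) (g t) := by
    rw [← contDiffOn_univ]
    exact hsmooth.comp (contDiffOn_const.prodMk contDiffOn_id) fun x _ => ⟨ht, mem_univ x⟩
  have hD (t : ℝ) (ht : 0 ≤ t) (k n : ℕ) :
      ∃ C, ∀ x, ‖x‖ ^ k * ‖iteratedFDeriv ℝ n (g t) x‖ ≤ C := by
    obtain ⟨C, hC⟩ := hbdd (t + 1) (by linarith) k n
    exact ⟨C, hC t ⟨ht, by linarith⟩⟩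
  let G : ℝ → 𝓢(V3, F) := fun t => if ht : 0 ≤ t then ⟨g t, hS t ht, hD t ht⟩ else 0
  have hG (t : ℝ) (ht : 0 ≤ t) : ⇑(G t) = g t := by
    simp only [G, dif_pos ht]
    rfl
  refine ⟨G, hG, ?_, fun T => ?_⟩
  · refine (hsmooth.mono (prod_mono Ioi_subset_Ici_self subset_rfl)).congr fun q hq => ?_
    rw [hG q.1 (le_of_lt hq.1)]
  · rw [(schwartz_withSeminorms ℝ V3 F).isVonNBounded_iff_seminorm_bounded]
    rintro ⟨k, n⟩
    rcases le_or_gt T 0 with hT | hT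
    · exact ⟨1, one_pos, by simp [Ioc_eq_empty_of_le hT]⟩
    · obtain ⟨C, hC⟩ := hbdd T hT k n
      refine ⟨|C| + 1, by positivity, ?_⟩
      rintro _ ⟨t, ht, rfl⟩
      refine lt_of_le_of_lt (seminorm_le_bound ℝ k n (G t) (abs_nonneg C) fun x => ?_)
        (lt_add_one _)
      rw [hG t ht.1.le]
      exact (hC t ⟨ht.1.le, ht.2⟩ x).trans (le_abs_self C)

end SchwartzMap

namespace SchwartzMap

open Bornology

/-- The `i`-th component of a Schwartz vector field. -/
def comp3 (i : Fin 3) : 𝓢(V3, Fin 3 → ℝ) →L[ℝ] 𝓢(V3, ℝ) :=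
  postcompCLM (ContinuousLinearMap.proj (R := ℝ) (φ := fun _ : Fin 3 => ℝ) i)

theorem comp3_apply (i : Fin 3) (G : 𝓢(V3, Fin 3 → ℝ)) (x : V3) : comp3 i G x = G x i := rfl

theorem pd_coe (j : Fin 3) (G : 𝓢(V3, Fin 3 → ℝ)) :
    pd j G = ⇑(∂_{eV j} G : 𝓢(V3, Fin 3 → ℝ)) := rfl

theorem lineDeriv_coe_apply (j i : Fin 3) (G : 𝓢(V3, Fin 3 → ℝ)) (x : V3) :
    (∂_{eV j} G : 𝓢(V3, Fin 3 → ℝ)) x i = dS j (comp3 i G) x := by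
  have h := (ContinuousLinearMap.proj (R := ℝ) (φ := fun _ : Fin 3 => ℝ) i).hasFDerivAt.comp x
    (G.differentiableAt (x := x)).hasFDerivAt
  exact (DFunLike.congr_fun h.fderiv (eV j)).symm

theorem comp3_lineDeriv (j i : Fin 3) (G : 𝓢(V3, Fin 3 → ℝ)) :
    comp3 i (∂_{eV j} G : 𝓢(V3, Fin 3 → ℝ)) = dS j (comp3 i G) :=
  SchwartzMap.ext (lineDeriv_coe_apply j i G)

theorem pd_apply (j i : Fin 3) (G : 𝓢(V3, Fin 3 → ℝ)) (x : V3) :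
    pd j G x i = dS j (comp3 i G) x := lineDeriv_coe_apply j i G x

theorem pd_pd_apply (j i : Fin 3) (G : 𝓢(V3, Fin 3 → ℝ)) (x : V3) :
    pd j (pd j G) x i = dS j (dS j (comp3 i G)) x := by
  rw [pd_coe, pd_apply, comp3_lineDeriv]

end SchwartzMap

open SchwartzMap Bornology

/-- The components of an unforced classical solution as curves in the Schwartz space. -/
theorem ClassicalSolution.exists_evol {α β ν : ℝ} {u₀ : V3 → Fin 3 → ℝ}
    (sol : ClassicalSolution α β ν u₀ (fun _ _ => 0)) :
    ∃ (U N W : Fin 3 → ℝ → 𝓢(V3, ℝ)) (P : ℝ → 𝓢(V3, ℝ)),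
      (∀ t > 0, ∀ x i, U i t x = sol.u t x i) ∧ (∀ i, Evol (U i) (W i)) ∧
      (∀ t > 0, ∀ i, W i t = -N i t + ν • lapS (U i t) - dS i (P t) - β • U i t) ∧
      (∀ t > 0, ∑ i, dS i (U i t) = 0) ∧
      ∀ t > 0, ∀ i, helm α (N i t) = adv (fun j => U j t) (U i t) := by
  obtain ⟨u, hu, hus, hub⟩ := exists_bundled sol.reg_u
  obtain ⟨n, hn, -, hnb⟩ := exists_bundled sol.reg_N
  obtain ⟨p, hp, -, hpb⟩ := exists_bundled sol.reg_p
  have hUs (i : Fin 3) :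
      ContDiffOn ℝ (⊤ : ℕ∞) (fun q : ℝ × V3 => comp3 i (u q.1) q.2) (Ioi 0 ×ˢ univ) :=
    (ContinuousLinearMap.proj (R := ℝ) (φ := fun _ : Fin 3 => ℝ) i).contDiff.comp_contDiffOn hus
  have hUb (i : Fin 3) (T : ℝ) : IsVonNBounded ℝ ((fun t => comp3 i (u t)) '' Ioc 0 T) := by
    rw [← image_image (comp3 i) u]; exact (hub T).image _
  refine ⟨fun i t => comp3 i (u t), fun i t => comp3 i (n t),
    fun i t => -comp3 i (n t) + ν • lapS (comp3 i (u t)) - dS i (p t) - β • comp3 i (u t), p,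
    fun t ht x i => ?_, fun i => ⟨hUs i, hUb i, fun T => ?_, fun t ht x => ?_⟩,
    fun t _ i => rfl, fun t ht => ?_, fun t ht i => ?_⟩
  · rw [comp3_apply, hu t ht.le]
  · have h1 := (hnb T).image (-comp3 i)
    have h2 := (hub T).image (ν • (lapS ∘L comp3 i))
    have h3 := (hpb T).image (-dS i)
    have h4 := (hub T).image (-(β • comp3 i))
    refine (((h1.add h2).add h3).add h4).subset ?_
    rintro _ ⟨t, ht, rfl⟩
    simp only [sub_eq_add_neg]
    exact add_mem_add (add_mem_add (add_mem_add ⟨_, mem_image_of_mem n ht, rfl⟩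
      ⟨_, mem_image_of_mem u ht, rfl⟩) ⟨_, mem_image_of_mem p ht, rfl⟩)
      ⟨_, mem_image_of_mem u ht, rfl⟩
  · have hd := hasDerivAt_of_smooth (U := fun t => comp3 i (u t)) (hUs i) (q := (t, x)) ht
    refine hd.congr_deriv ?_
    have hev : (fun s => sol.u s x i) =ᶠ[nhds t] fun s => comp3 i (u s) x := by
      filter_upwards [Ioi_mem_nhds ht] with s hs
      rw [comp3_apply, hu s (le_of_lt hs)]
    have hm := sol.momentum t ht.le x i
    rw [derivWithin_of_mem_nhds (Ici_mem_nhds ht), hev.deriv_eq, hd.deriv, ← hu t ht.le,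
      ← hn t ht.le, ← hp t ht.le] at hm
    simp only [pd_pd_apply, zero_sub] at hm
    change _ + _ - _ + dS i (p t) x = _ at hm
    simp only [sub_apply, add_apply, neg_apply, smul_apply, lapS_apply, sum_apply, smul_eq_mul,
      comp3_apply] at hm ⊢
    linarith
  · ext x
    have h := sol.divFree t ht.le x
    rw [← hu t ht.le] at h
    simpa only [sum_apply, pd_apply, zero_apply] using h
  · ext x
    have h := sol.filter t ht.le x i
    rw [← hu t ht.le, ← hn t ht.le] at h
    simp only [pd_pd_apply, pd_apply] at h
    simp only [helm_apply, adv, sub_apply, smul_apply, lapS_apply, sum_apply, mulS_apply,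
      smul_eq_mul, comp3_apply] at h ⊢
    linarith

/-- Exponential decay of the `H¹_α` energy and boundedness of `u`. -/
theorem ClassicalSolution.exists_decay {α β ν : ℝ} (hα : 0 < α) (hβ : 0 < β) (hν : 0 < ν)
    {u₀ : V3 → Fin 3 → ℝ} (sol : ClassicalSolution α β ν u₀ (fun _ _ => 0)) :
    ∃ A > 0, ∃ M > 0, ∀ t ≥ 1, (∀ x, ∑ i, (sol.u t x i) ^ 2 ≤ M) ∧
      Integrable (fun x => ∑ i, (sol.u t x i) ^ 2) ∧
      ∫ x, ∑ i, (sol.u t x i) ^ 2 ≤ A * Real.exp (-(2 * β) * t) := by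
  obtain ⟨U, N, W, P, hU, hev, hW, hdiv, hfil⟩ := sol.exists_evol
  obtain ⟨K, hK, HK⟩ := exists_abs_sum_ip_adv_le hα
  obtain ⟨C, hC, HC⟩ := exists_sq_apply_le_en hα
  set E : ℝ → ℝ := fun t => ∑ i, en α (U i t) with hEdef
  set F : ℝ → ℝ := fun t => ∑ k, ∑ i, en α (dS k (U i t)) with hFdef
  have hE0 (t : ℝ) : 0 ≤ E t := Finset.sum_nonneg fun i _ => en_nonneg α _
  have hF0 (t : ℝ) : 0 ≤ F t :=
    Finset.sum_nonneg fun k _ => Finset.sum_nonneg fun i _ => en_nonneg α _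
  have hE : ∀ t > 0, HasDerivAt E (-(2 * ν) * F t - 2 * β * E t) t := fun t ht => by
    refine (HasDerivAt.fun_sum fun i _ => (hev i).hasDerivAt_en α ht).congr_deriv ?_
    rw [← Finset.mul_sum, sum_ip_helm α β ν (fun i => U i t) (fun i => N i t) _ (P t) (hdiv t ht)
      (hW t ht)]
    simp only [hfil t ht, ip_adv_self _ _ (hdiv t ht), Finset.sum_const_zero]
    ring
  have hF : ∀ t > 0, HasDerivAt F
      (∑ k, ∑ i, 2 * ip (dS k (W i t)) (helm α (dS k (U i t)))) t := fun t ht =>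
    HasDerivAt.fun_sum fun k _ => HasDerivAt.fun_sum fun i _ =>
      ((hev i).dS k).hasDerivAt_en α ht
  obtain ⟨hdec, M, hM, HM⟩ := energy_decay hβ hν hK hE0 hF0 hE hF fun t ht => by
    have h1 (k : Fin 3) : ∑ i, 2 * ip (dS k (W i t)) (helm α (dS k (U i t))) ≤
        -2 * (∑ i, ip (dS k (adv (fun j => U j t) (U i t))) (dS k (U i t)))
          - 2 * β * ∑ i, en α (dS k (U i t)) := by
      rw [← Finset.mul_sum, sum_ip_helm α β ν (fun i => dS k (U i t)) (fun i => dS k (N i t)) _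
        (dS k (P t))]
      · have h2 : 0 ≤ ν * ∑ l, ∑ i, en α (dS l (dS k (U i t))) := mul_nonneg hν.le <|
          Finset.sum_nonneg fun l _ => Finset.sum_nonneg fun i _ => en_nonneg α _
        simp only [← dS_helm, hfil t ht]
        linarith
      · simp only [dS_comm _ k, ← map_sum, hdiv t ht, map_zero]
      · intro i
        rw [hW t ht i, dS_comm i k]
        simp only [map_sub, map_add, map_neg, map_smul, dS_lapS]
    refine (Finset.sum_le_sum fun k _ => h1 k).trans ?_
    rw [Finset.sum_sub_distrib, ← Finset.mul_sum, ← Finset.mul_sum]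
    have h2 := (neg_le_abs _).trans (HK fun j => U j t)
    change _ ≤ K * √(E t) * (E t + F t) at h2
    change _ - 2 * β * F t ≤ _
    linarith
  have hbound {t : ℝ} (ht : 0 < t) (x : V3) : ∑ i, (sol.u t x i) ^ 2 ≤ C * (E t + F t) := by
    calc ∑ i, (sol.u t x i) ^ 2 ≤ ∑ i, C * (en α (U i t) + ∑ k, en α (dS k (U i t))) :=
          Finset.sum_le_sum fun i _ => by rw [← hU t ht]; exact HC _ x
      _ = C * (E t + F t) := by
          rw [← Finset.mul_sum, Finset.sum_add_distrib, Finset.sum_comm]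
  refine ⟨(E 1 + 1) * Real.exp (2 * β), by have := hE0 1; positivity, C * M, by positivity,
    fun t ht => ?_⟩
  have ht0 : 0 < t := zero_lt_one.trans_le ht
  have hsq (i : Fin 3) : Integrable fun x => (sol.u t x i) ^ 2 := by
    simpa only [hU t ht0, ← sq] using integrable_mul (U i t) (U i t)
  refine ⟨fun x => (hbound ht0 x).trans (by have := HM t ht; gcongr),
    integrable_finsetSum _ fun i _ => hsq i, ?_⟩
  calc ∫ x, ∑ i, (sol.u t x i) ^ 2 = ∑ i, ip (U i t) (U i t) := by
        rw [integral_finsetSum _ fun i _ => hsq i]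
        simp only [ip_apply, hU t ht0, ← sq]
    _ ≤ E t := Finset.sum_le_sum fun i _ => le_add_of_nonneg_right <|
        mul_nonneg (sq_nonneg α) (Finset.sum_nonneg fun k _ => ip_self_nonneg _)
    _ ≤ E 1 * Real.exp (-(2 * β) * (t - 1)) := hdec t ht
    _ ≤ (E 1 + 1) * Real.exp (-(2 * β) * (t - 1)) := by gcongr; linarith
    _ = (E 1 + 1) * Real.exp (2 * β) * Real.exp (-(2 * β) * t) := by
        rw [mul_assoc, ← Real.exp_add]; ring_nf

/-- Exponential decay of all `L^q` norms for the damped equations without external force. -/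
theorem decay_zero_force (α β ν : ℝ) (hα : 0 < α) (hβ : 0 < β) (hν : 0 < ν)
    (u₀ : V3 → Fin 3 → ℝ)
    (sol : ClassicalSolution α β ν u₀ (fun _ _ => 0))
    (q : ℝ) (hq : 2 ≤ q) :
    ∃ C > (0:ℝ), ∃ t₀ ≥ (1:ℝ), ∀ t ≥ t₀,
      (∫ x : V3, (Real.sqrt (∑ i, (sol.u t x i)^2)) ^ q) ^ (1/q)
        ≤ C * Real.exp (-(2 * β / q) * t) := by
  obtain ⟨A, hA, M, hM, H⟩ := sol.exists_decay hα hβ hν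
  have hq0 : 0 < q := by linarith
  set B := √M ^ (q - 2) * A with hB
  have hB0 : 0 < B := by positivity
  refine ⟨B ^ (1 / q), by positivity, 1, le_rfl, fun t ht => ?_⟩
  obtain ⟨hsup, hint, hdec⟩ := H t ht
  have hpt (x : V3) : √(∑ i, (sol.u t x i) ^ 2) ^ q ≤
      √M ^ (q - 2) * ∑ i, (sol.u t x i) ^ 2 := by
    have hx : 0 ≤ ∑ i, (sol.u t x i) ^ 2 := Finset.sum_nonneg fun i _ => sq_nonneg _
    have h1 : √(∑ i, (sol.u t x i) ^ 2) ^ q =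
        √(∑ i, (sol.u t x i) ^ 2) ^ (q - 2) * ∑ i, (sol.u t x i) ^ 2 := by
      nth_rewrite 3 [← Real.sq_sqrt hx]
      rw [← Real.rpow_ofNat, ← Real.rpow_add_of_nonneg (Real.sqrt_nonneg _) (by linarith)
        two_pos.le, sub_add_cancel]
    rw [h1]
    exact mul_le_mul_of_nonneg_right
      (Real.rpow_le_rpow (Real.sqrt_nonneg _) (Real.sqrt_le_sqrt (hsup x)) (by linarith)) hx
  have hI : ∫ x : V3, √(∑ i, (sol.u t x i) ^ 2) ^ q ≤ B * Real.exp (-(2 * β) * t) := by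
    calc ∫ x : V3, √(∑ i, (sol.u t x i) ^ 2) ^ q
        ≤ ∫ x : V3, √M ^ (q - 2) * ∑ i, (sol.u t x i) ^ 2 :=
          integral_mono_of_nonneg (Filter.Eventually.of_forall fun x => by positivity)
            (hint.const_mul _) (Filter.Eventually.of_forall hpt)
      _ ≤ √M ^ (q - 2) * (A * Real.exp (-(2 * β) * t)) := by
          rw [integral_const_mul]; gcongr
      _ = B * Real.exp (-(2 * β) * t) := by ring
  refine (Real.rpow_le_rpow (integral_nonneg fun x => by positivity) hI (by positivity)).trans
    (le_of_eq ?_)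
  rw [Real.mul_rpow hB0.le (Real.exp_pos _).le, ← Real.exp_mul]
  congr 2
  field_simp

end
end

section
/- Let m ≥ 1 be an integer, let u be a Schwartz-class vector field on ℝ³ with div u = 0, and let w₁, …, w_m be Schwartz-class divergence-free vector fields on ℝ³ forming an orthonormal family with respect to the inner product [v, w]_α = ∫_{ℝ³} v·w dx + α² ∫_{ℝ³} Dv : Dw dx. Then | Σ_{i=1}^m ∫_{ℝ³} ((w_i·∇)u)·w_i dx | ≤ 2 C_{LT}⁴ ν^{−12/5} α^{−6/5} ‖u‖_{Ḣ¹}^{14/5} + (3/8) α² ‖u‖²_{Ḣ²} + (3ν/5) Σ_{i=1}^m ‖w_i‖²_{Ḣ¹}, where C_{LT} = (3/5^{5/3}) ( 16 π^{3/2} Γ(7/2)/Γ(5) )^{2/3} is the Lieb–Thirring constant. -/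
open MeasureTheory Set

noncomputable section

/-- The `H¹_α` inner product. -/
def innerA (α : ℝ) (v w : V3 → Fin 3 → ℝ) : ℝ :=
  (∫ x : V3, ∑ i, v x i * w x i) + α^2 * ∫ x : V3, ∑ i, ∑ j, pd j v x i * pd j w x i

/-- The Lieb–Thirring constant. -/
def CLT : ℝ :=
  3 / 5 ^ ((5:ℝ)/3) * (16 * Real.pi ^ ((3:ℝ)/2) * Real.Gamma (7/2) / Real.Gamma 5) ^ ((2:ℝ)/3)

section

open scoped SchwartzMap LineDeriv ENNReal

theorem sq_lintegral_le {Ω : Type*} [MeasurableSpace Ω] {P : Measure Ω} [IsProbabilityMeasure P]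
    {F : Ω → ℝ≥0∞} (hF : AEMeasurable F P) : (∫⁻ t, F t ∂P) ^ 2 ≤ ∫⁻ t, F t ^ 2 ∂P := by
  have h := ENNReal.lintegral_mul_norm_pow_le (μ := P) (f := fun t => F t ^ 2) (g := fun _ => 1)
    (hF.pow_const 2) aemeasurable_const (p := 1/2) (q := 1/2) (by norm_num) (by norm_num)
    (by norm_num)
  have e : ∀ t, (F t ^ 2) ^ (1/2:ℝ) = F t := by
    intro t
    rw [← ENNReal.rpow_natCast, ← ENNReal.rpow_mul]
    norm_num
  simp only [lintegral_one, measure_univ, ENNReal.one_rpow, mul_one, e] at h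
  calc (∫⁻ t, F t ∂P) ^ 2 ≤ ((∫⁻ t, F t ^ 2 ∂P) ^ (1/2:ℝ)) ^ 2 := by gcongr
    _ = _ := by
      rw [← ENNReal.rpow_natCast, ← ENNReal.rpow_mul]
      norm_num

theorem lintegral_enorm_sq_eq {Ω : Type*} [MeasurableSpace Ω] {P : Measure Ω} {a : Ω → ℝ}
    (ha : MemLp a 2 P) : ∫⁻ x, ‖a x‖ₑ ^ 2 ∂P = ENNReal.ofReal (∫ x, a x ^ 2 ∂P) := by
  rw [ofReal_integral_eq_lintegral_ofReal ha.integrable_sq (ae_of_all _ fun x => sq_nonneg _)]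
  refine lintegral_congr fun x => ?_
  rw [← sq_abs, ENNReal.ofReal_pow (abs_nonneg _), Real.enorm_eq_ofReal_abs]

theorem memLp_shift {f : V3 → ℝ} (hf : MemLp f 2) (h : V3) : MemLp (fun x => f (x + h)) 2 :=
  hf.comp_measurePreserving (measurePreserving_add_right volume h)

/-- Squared `L²` norm of a first difference. -/
def shiftEnergy (f : V3 → ℝ) (h : V3) : ℝ := ∫ x, (f (x + h) - f x) ^ 2

theorem shiftEnergy_nonneg (f : V3 → ℝ) (h : V3) : 0 ≤ shiftEnergy f h :=
  integral_nonneg fun _ => sq_nonneg _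

theorem integral_sq_second_difference {f : V3 → ℝ} (hf : MemLp f 2) (h : V3) :
    ∫ x, (f (x + h) + f (x - h) - 2 * f x) ^ 2
      = 4 * shiftEnergy f h - shiftEnergy f ((2:ℝ) • h) := by
  have h1 := memLp_shift hf h
  have h2 : MemLp (fun x => f (x - h)) 2 := by
    simpa [sub_eq_add_neg] using memLp_shift hf (-h)
  have i1 : Integrable fun x => (f (x + h) - f x) ^ 2 := (h1.sub hf).integrable_sq
  have i2 : Integrable fun x => (f x - f (x - h)) ^ 2 := (hf.sub h2).integrable_sq
  have i3 : Integrable fun x => (f (x + h) - f (x - h)) ^ 2 := (h1.sub h2).integrable_sq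
  have e2 : ∫ x, (f x - f (x - h)) ^ 2 = shiftEnergy f h := by
    rw [shiftEnergy, ← integral_add_right_eq_self (fun x => (f x - f (x - h)) ^ 2) h]
    simp
  have e3 : ∫ x, (f (x + h) - f (x - h)) ^ 2 = shiftEnergy f ((2:ℝ) • h) := by
    rw [shiftEnergy, ← integral_add_right_eq_self (fun x => (f (x + h) - f (x - h)) ^ 2) h]
    simp [two_smul, add_assoc]
  have : ∀ x, (f (x + h) + f (x - h) - 2 * f x) ^ 2
      = 2 * (f (x + h) - f x) ^ 2 + 2 * (f x - f (x - h)) ^ 2 - (f (x + h) - f (x - h)) ^ 2 := by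
    intro x; ring
  simp_rw [this]
  have i4 : Integrable fun x => 2 * (f (x + h) - f x) ^ 2 + 2 * (f x - f (x - h)) ^ 2 :=
    (i1.const_mul 2).add (i2.const_mul 2)
  rw [integral_sub i4 i3, integral_add (i1.const_mul 2) (i2.const_mul 2), integral_const_mul, integral_const_mul, e2, e3,
    shiftEnergy]
  ring

theorem memLp_lineDeriv (f : 𝓢(V3, ℝ)) (h : V3) : MemLp (fun x => fderiv ℝ f x h) 2 :=
  ((∂_{h} f).memLp 2 volume).ae_eq (ae_of_all _ fun x => SchwartzMap.lineDerivOp_apply_eq_fderiv h f x)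

theorem continuous_lineDeriv (f : 𝓢(V3, ℝ)) (h : V3) : Continuous (fun x => fderiv ℝ f x h) := by
  have e : (fun x => fderiv ℝ f x h) = ⇑(∂_{h} f : 𝓢(V3, ℝ)) :=
    funext fun x => (SchwartzMap.lineDerivOp_apply_eq_fderiv h f x).symm
  rw [e]
  exact (∂_{h} f : 𝓢(V3, ℝ)).continuous

theorem shiftEnergy_le (f : 𝓢(V3, ℝ)) (h : V3) :
    shiftEnergy f h ≤ ∫ x, (fderiv ℝ f x h) ^ 2 := by
  have hf : MemLp f 2 := f.memLp 2 volume
  have hm : MemLp (fun x => f (x + h) - f x) 2 := (memLp_shift hf h).sub hf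
  rw [← ENNReal.ofReal_le_ofReal_iff (integral_nonneg fun _ => sq_nonneg _), shiftEnergy,
    ← lintegral_enorm_sq_eq (memLp_lineDeriv f h), ← lintegral_enorm_sq_eq hm]
  have hc : Continuous fun p : V3 × ℝ => fderiv ℝ f (p.1 + p.2 • h) h :=
    (continuous_lineDeriv f h).comp (by fun_prop)
  have hP : IsProbabilityMeasure (volume.restrict (Ioc (0:ℝ) 1)) := ⟨by simp⟩
  have key : ∀ x, ‖f (x + h) - f x‖ₑ ^ 2
      ≤ ∫⁻ t in Ioc (0:ℝ) 1, ‖fderiv ℝ f (x + t • h) h‖ₑ ^ 2 := by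
    intro x
    have hcx : Continuous fun t : ℝ => fderiv ℝ f (x + t • h) h :=
      (continuous_lineDeriv f h).comp (by fun_prop : Continuous fun t : ℝ => x + t • h)
    have hd : ∀ t ∈ uIcc (0:ℝ) 1,
        HasDerivAt (fun t : ℝ => f (x + t • h)) (fderiv ℝ f (x + t • h) h) t := by
      intro t _
      have h1 : HasDerivAt (fun t : ℝ => x + t • h) h t := by
        simpa using ((hasDerivAt_id t).smul_const h).const_add x
      exact (f.hasFDerivAt (x + t • h)).comp_hasDerivAt t h1
    have e := intervalIntegral.integral_eq_sub_of_hasDerivAt hd (hcx.intervalIntegrable _ _)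
    rw [intervalIntegral.integral_of_le zero_le_one] at e
    simp only [one_smul, zero_smul, add_zero] at e
    rw [← e]
    refine le_trans ?_ (sq_lintegral_le hcx.enorm.measurable.aemeasurable)
    gcongr
    exact enorm_integral_le_lintegral_enorm _
  calc ∫⁻ x, ‖f (x + h) - f x‖ₑ ^ 2
      ≤ ∫⁻ x, ∫⁻ t in Ioc (0:ℝ) 1, ‖fderiv ℝ f (x + t • h) h‖ₑ ^ 2 := lintegral_mono key
    _ = ∫⁻ t in Ioc (0:ℝ) 1, ∫⁻ x, ‖fderiv ℝ f (x + t • h) h‖ₑ ^ 2 :=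
        lintegral_lintegral_swap (hc.enorm.measurable.pow_const 2).aemeasurable
    _ = ∫⁻ t in Ioc (0:ℝ) 1, ∫⁻ x, ‖fderiv ℝ f x h‖ₑ ^ 2 := by
        refine lintegral_congr fun t => ?_
        exact lintegral_add_right_eq_self (fun x => ‖fderiv ℝ f x h‖ₑ ^ 2) (t • h)
    _ = _ := by simp

theorem tsum_second_difference_le (f : 𝓢(V3, ℝ)) (h : V3) :
    ∑' n : ℤ, (4:ℝ≥0∞) ^ n * ∫⁻ x, ‖f (x + (2:ℝ) ^ (-n) • h) + f (x - (2:ℝ) ^ (-n) • h) - 2 * f x‖ₑ ^ 2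
      ≤ 4 * ∫⁻ x, ‖fderiv ℝ f x h‖ₑ ^ 2 := by
  have hf : MemLp f 2 := f.memLp 2 volume
  set D := ∫ x, (fderiv ℝ f x h) ^ 2 with hD
  rw [lintegral_enorm_sq_eq (memLp_lineDeriv f h), ← hD]
  set g : ℤ → ℝ := fun n => 4 * ((4:ℝ) ^ n * shiftEnergy f ((2:ℝ) ^ (-n) • h)) with hg
  have g0 : ∀ n, 0 ≤ g n := fun n => by
    have := shiftEnergy_nonneg f ((2:ℝ) ^ (-n) • h)
    simp only [hg]; positivity
  have gD : ∀ n, g n ≤ 4 * D := by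
    intro n
    have h1 := shiftEnergy_le f ((2:ℝ) ^ (-n) • h)
    simp only [map_smul, smul_eq_mul, mul_pow, integral_const_mul] at h1
    have h2 : (4:ℝ) ^ n * ((2:ℝ) ^ (-n)) ^ 2 = 1 := by
      rw [show (4:ℝ) = 2 ^ 2 by norm_num, zpow_neg, ← zpow_natCast, ← zpow_natCast, ← zpow_mul,
        ← inv_zpow, ← zpow_mul, mul_comm n, inv_zpow]
      exact mul_inv_cancel₀ (by positivity)
    have h3 : (4:ℝ) ^ n * shiftEnergy f ((2:ℝ) ^ (-n) • h) ≤ D := by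
      calc _ ≤ (4:ℝ) ^ n * (((2:ℝ) ^ (-n)) ^ 2 * D) := by gcongr
        _ = D := by rw [← mul_assoc, h2, one_mul]
    simp only [hg]; linarith
  have gdiff : ∀ n, g n - g (n - 1) = (4:ℝ) ^ n * (4 * shiftEnergy f ((2:ℝ) ^ (-n) • h)
      - shiftEnergy f ((2:ℝ) • (2:ℝ) ^ (-n) • h)) := by
    intro n
    simp only [hg]
    have e5 : (2:ℝ) • (2:ℝ) ^ (-n) • h = (2:ℝ) ^ (-(n-1)) • h := by
      rw [smul_smul]; congr 1
      rw [show -(n-1) = 1 + -n by ring, zpow_add₀ (by norm_num)]; simp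
    have e6 : (4:ℝ) ^ n = 4 * (4:ℝ) ^ (n-1) := by
      rw [zpow_sub_one₀ (by norm_num)]; field_simp
    rw [e5, e6]; ring
  have term : ∀ n : ℤ, (4:ℝ≥0∞) ^ n *
      ∫⁻ x, ‖f (x + (2:ℝ) ^ (-n) • h) + f (x - (2:ℝ) ^ (-n) • h) - 2 * f x‖ₑ ^ 2
      = ENNReal.ofReal (g n - g (n - 1)) := by
    intro n
    have h1 := memLp_shift hf ((2:ℝ) ^ (-n) • h)
    have h2 : MemLp (fun x => f (x - (2:ℝ) ^ (-n) • h)) 2 := by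
      simpa [sub_eq_add_neg] using memLp_shift hf (-((2:ℝ) ^ (-n) • h))
    have h3 := (h1.add h2).sub (hf.const_mul 2)
    have e4 : (4:ℝ≥0∞) ^ n = ENNReal.ofReal ((4:ℝ) ^ n) := by
      rw [show ((4:ℝ) ^ n) = (((4:NNReal) ^ n : NNReal) : ℝ) by push_cast; rfl,
        ENNReal.ofReal_coe_nnreal, ENNReal.coe_zpow (by norm_num)]
      norm_num
    have := lintegral_enorm_sq_eq h3
    simp only [Pi.add_apply, Pi.sub_apply] at this
    rw [this, integral_sq_second_difference hf, e4, ← ENNReal.ofReal_mul (by positivity)]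
    rw [gdiff]
  have gmono : ∀ n, g (n - 1) ≤ g n := by
    intro n
    have h1 : 0 ≤ 4 * shiftEnergy f ((2:ℝ) ^ (-n) • h)
        - shiftEnergy f ((2:ℝ) • (2:ℝ) ^ (-n) • h) := by
      rw [← integral_sq_second_difference hf]
      exact integral_nonneg fun _ => sq_nonneg _
    rw [← sub_nonneg, gdiff]
    positivity
  simp_rw [term]
  rw [ENNReal.tsum_eq_iSup_sum]
  refine iSup_le fun s => ?_
  obtain ⟨N, hN⟩ : ∃ N : ℕ, s ⊆ (Finset.range (2 * N)).image (fun k : ℕ => (k:ℤ) - N + 1) := by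
    refine ⟨s.sup Int.natAbs + 1, fun n hn => ?_⟩
    have := Finset.le_sup (f := Int.natAbs) hn
    simp only [Finset.mem_image, Finset.mem_range]
    exact ⟨(n + (s.sup Int.natAbs + 1 : ℕ) - 1).toNat, by omega, by omega⟩
  calc ∑ n ∈ s, ENNReal.ofReal (g n - g (n - 1))
      ≤ ∑ n ∈ (Finset.range (2 * N)).image (fun k : ℕ => (k:ℤ) - N + 1),
          ENNReal.ofReal (g n - g (n - 1)) := Finset.sum_le_sum_of_subset hN
    _ = ∑ k ∈ Finset.range (2 * N), ENNReal.ofReal (g ((k + 1 : ℕ) - N) - g (k - N)) := by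
        rw [Finset.sum_image fun a _ b _ hab => by simpa using hab]
        refine Finset.sum_congr rfl fun k _ => ?_
        congr 3 <;> push_cast <;> ring
    _ = ENNReal.ofReal (g ((2 * N : ℕ) - N) - g ((0 : ℕ) - N)) := by
        rw [← ENNReal.ofReal_sum_of_nonneg, Finset.sum_range_sub (fun k : ℕ => g ((k:ℤ) - N))]
        intro k _
        have := gmono ((k + 1 : ℕ) - N)
        rw [show (((k + 1 : ℕ) : ℤ) - N - 1) = k - N by push_cast; ring] at this
        linarith
    _ ≤ ENNReal.ofReal (4 * D) := by
        apply ENNReal.ofReal_le_ofReal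
        linarith [gD ((2 * N : ℕ) - N), g0 ((0 : ℕ) - N)]
    _ = 4 * ENNReal.ofReal D := by
        rw [ENNReal.ofReal_mul (by norm_num)]; norm_num

/-- Lebesgue measure on the unit cube centred at the origin. -/
def cubeMeasure : Measure V3 :=
  Measure.pi fun _ => (volume : Measure ℝ).restrict (Icc (-(1/2)) (1/2))

instance isProbabilityMeasure_cubeMeasure : IsProbabilityMeasure cubeMeasure := by
  have : IsProbabilityMeasure ((volume : Measure ℝ).restrict (Icc (-(1/2)) (1/2))) :=
    ⟨by simp; norm_num⟩
  unfold cubeMeasure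
  infer_instance

theorem cubeMeasure_eq :
    cubeMeasure = volume.restrict (univ.pi fun _ => Icc (-(1/2)) (1/2)) := by
  unfold cubeMeasure
  rw [← Measure.restrict_pi_pi]
  rfl

theorem integrable_cubeMeasure {g : V3 → ℝ} (hg : Continuous g) : Integrable g cubeMeasure := by
  rw [cubeMeasure_eq]
  exact hg.continuousOn.integrableOn_compact (isCompact_univ_pi fun _ => isCompact_Icc)

theorem cubeMeasure_le : cubeMeasure ≤ volume := by
  rw [cubeMeasure_eq]
  exact Measure.restrict_le_self

theorem measurePreserving_neg_cubeMeasure :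
    MeasurePreserving (fun h : V3 => -h) cubeMeasure cubeMeasure := by
  refine measurePreserving_pi _ _ (f := fun _ t => -t) fun _ => ?_
  have := (Measure.measurePreserving_neg (volume : Measure ℝ)).restrict_preimage
    (measurableSet_Icc (a := -(1/2:ℝ)) (b := 1/2))
  simpa using this

theorem integral_mul_cubeMeasure (i j : Fin 3) :
    ∫ h, h i * h j ∂cubeMeasure = if i = j then 1/12 else 0 := by
  have h := integral_fintype_prod_eq_prod (𝕜 := ℝ) (ι := Fin 3) (E := fun _ => ℝ)
    (μ := fun _ => (volume : Measure ℝ).restrict (Icc (-(1/2)) (1/2)))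
    (fun k t => (if k = i then t else 1) * (if k = j then t else 1))
  have e : ∀ x : V3, x i * x j
      = ∏ k, ((if k = i then x k else 1) * (if k = j then x k else 1)) := by
    intro x; rw [Finset.prod_mul_distrib]; simp
  simp_rw [e]
  rw [cubeMeasure, h]
  have c : ∀ F : ℝ → ℝ, ∫ t in Icc (-(1/2):ℝ) (1/2), F t = ∫ t in (-(1/2):ℝ)..(1/2), F t := by
    intro F
    rw [integral_Icc_eq_integral_Ioc, intervalIntegral.integral_of_le (by norm_num)]
  simp_rw [c]
  have m1 : ∫ t in (-(1/2):ℝ)..(1/2), (1:ℝ) = 1 := by simp; norm_num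
  have m2 : ∫ t in (-(1/2):ℝ)..(1/2), t = 0 := by simp
  have m3 : ∫ t in (-(1/2):ℝ)..(1/2), t * t = 1/12 := by
    simp_rw [← sq]; rw [integral_pow]; norm_num
  fin_cases i <;> fin_cases j <;> simp [Fin.prod_univ_three] at m1 m2 m3 ⊢ <;> simp [m1, m3]

theorem integral_sum_mul_sq_cubeMeasure (d : Fin 3 → ℝ) :
    ∫ h, (∑ j, h j * d j) ^ 2 ∂cubeMeasure = 1/12 * ∑ j, d j ^ 2 := by
  have hi : ∀ i j, Integrable (fun h : V3 => h i * h j) cubeMeasure :=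
    fun i j => integrable_cubeMeasure (by fun_prop)
  have e : ∀ h : V3, (∑ j, h j * d j) ^ 2 = ∑ i, ∑ j, d i * d j * (h i * h j) := by
    intro h
    rw [sq, Finset.sum_mul_sum]
    exact Finset.sum_congr rfl fun i _ => Finset.sum_congr rfl fun j _ => by ring
  simp_rw [e]
  rw [integral_finsetSum _ fun i _ => integrable_finsetSum _ fun j _ => (hi i j).const_mul _]
  simp_rw [integral_finsetSum Finset.univ fun j _ => (hi _ j).const_mul _, integral_const_mul,
    integral_mul_cubeMeasure]
  simp [Finset.mul_sum]
  exact Finset.sum_congr rfl fun i _ => by ring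

/-- Average of `f` over the cube of side `ℓ` centred at `x`. -/
def cubeAvg (ℓ : ℝ) (f : V3 → ℝ) (x : V3) : ℝ := ∫ h, f (x + ℓ • h) ∂cubeMeasure

theorem integrable_comp_cube (f : 𝓢(V3, ℝ)) (x : V3) (ℓ : ℝ) :
    Integrable (fun h => f (x + ℓ • h)) cubeMeasure :=
  integrable_cubeMeasure (f.continuous.comp (by fun_prop))

theorem measurable_cubeAvg (f : 𝓢(V3, ℝ)) (ℓ : ℝ) : Measurable (cubeAvg ℓ f) := by
  have hc : Continuous fun p : V3 × V3 => f (p.1 + ℓ • p.2) := f.continuous.comp (by fun_prop)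
  exact (hc.stronglyMeasurable.integral_prod_right (ν := cubeMeasure)).measurable

theorem enorm_sub_cubeAvg_sq_le (f : 𝓢(V3, ℝ)) (x : V3) (ℓ : ℝ) :
    ‖f x - cubeAvg ℓ f x‖ₑ ^ 2
      ≤ 4⁻¹ * ∫⁻ h, ‖f (x + ℓ • h) + f (x - ℓ • h) - 2 * f x‖ₑ ^ 2 ∂cubeMeasure := by
  have i1 := integrable_comp_cube f x ℓ
  have i2 : Integrable (fun h => f (x - ℓ • h)) cubeMeasure := by
    simpa [sub_eq_add_neg] using integrable_comp_cube f x (-ℓ)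
  have e2 : ∫ h, f (x - ℓ • h) ∂cubeMeasure = cubeAvg ℓ f x := by
    have := measurePreserving_neg_cubeMeasure.integral_comp
      (MeasurableEquiv.neg V3).measurableEmbedding (fun h => f (x + ℓ • h))
    rw [cubeAvg, ← this]
    simp [sub_eq_add_neg]
  have e : f x - cubeAvg ℓ f x
      = -(1/2) * ∫ h, (f (x + ℓ • h) + f (x - ℓ • h) - 2 * f x) ∂cubeMeasure := by
    have i3 : Integrable (fun h => f (x + ℓ • h) + f (x - ℓ • h)) cubeMeasure := i1.add i2
    rw [integral_sub i3 (integrable_const _), integral_add i1 i2, e2]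
    simp [cubeAvg]; ring
  have hc : Continuous fun h : V3 => f (x + ℓ • h) + f (x - ℓ • h) - 2 * f x :=
    ((f.continuous.comp (by fun_prop)).add (f.continuous.comp (by fun_prop))).sub continuous_const
  rw [e, enorm_mul, mul_pow]
  have e4 : ‖(-(1/2):ℝ)‖ₑ ^ 2 = 4⁻¹ := by
    rw [enorm_neg, Real.enorm_eq_ofReal (by norm_num), ← ENNReal.ofReal_pow (by norm_num),
      show ((1/2:ℝ)^2) = (4:ℝ)⁻¹ by norm_num, ENNReal.ofReal_inv_of_pos (by norm_num)]
    norm_num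
  rw [e4]
  gcongr
  refine le_trans ?_ (sq_lintegral_le hc.enorm.measurable.aemeasurable)
  gcongr
  exact enorm_integral_le_lintegral_enorm _

theorem tsum_sub_cubeAvg_le (f : 𝓢(V3, ℝ)) :
    ∑' n : ℤ, (4:ℝ≥0∞) ^ n * ∫⁻ x, ‖f x - cubeAvg ((2:ℝ) ^ (-n)) f x‖ₑ ^ 2
      ≤ ENNReal.ofReal (1/12 * ∫ x, ∑ j, (fderiv ℝ f x (Pi.single j 1)) ^ 2) := by
  have meas : ∀ n : ℤ, Measurable fun p : V3 × V3 => ‖f (p.1 + (2:ℝ) ^ (-n) • p.2)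
      + f (p.1 - (2:ℝ) ^ (-n) • p.2) - 2 * f p.1‖ₑ ^ 2 := by
    intro n
    have hc : Continuous fun p : V3 × V3 => f (p.1 + (2:ℝ) ^ (-n) • p.2)
      + f (p.1 - (2:ℝ) ^ (-n) • p.2) - 2 * f p.1 :=
      ((f.continuous.comp (by fun_prop)).add (f.continuous.comp (by fun_prop))).sub
        (continuous_const.mul (f.continuous.comp continuous_fst))
    exact hc.enorm.measurable.pow_const 2
  have dexp : ∀ x h : V3, fderiv ℝ f x h = ∑ j, h j * fderiv ℝ f x (Pi.single j 1) := by
    intro x h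
    have e : h = ∑ j, h j • (Pi.single j 1 : V3) := by
      conv_lhs => rw [← Finset.univ_sum_single h]
      exact Finset.sum_congr rfl fun j _ => by rw [← Pi.single_smul, smul_eq_mul, mul_one]
    conv_lhs => rw [e, map_sum]
    simp only [map_smul, smul_eq_mul]
  have hD : Measurable fun p : V3 × V3 => ‖fderiv ℝ f p.2 p.1‖ₑ ^ 2 := by
    have hc : Continuous fun p : V3 × V3 => fderiv ℝ f p.2 p.1 := by
      have e : (fun p : V3 × V3 => fderiv ℝ f p.2 p.1)
          = fun p => ∑ j, p.1 j * fderiv ℝ f p.2 (Pi.single j 1) := funext fun p => dexp p.2 p.1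
      rw [e]
      refine continuous_finsetSum _ fun j _ => ?_
      exact (by fun_prop : Continuous fun p : V3 × V3 => p.1 j).mul
        ((continuous_lineDeriv f (Pi.single j 1)).comp continuous_snd)
    exact hc.enorm.measurable.pow_const 2
  calc _ ≤ ∑' n : ℤ, (4:ℝ≥0∞) ^ n * ∫⁻ x, 4⁻¹ * ∫⁻ h, ‖f (x + (2:ℝ) ^ (-n) • h)
          + f (x - (2:ℝ) ^ (-n) • h) - 2 * f x‖ₑ ^ 2 ∂cubeMeasure := by
        gcongr with n x
        exact enorm_sub_cubeAvg_sq_le f x _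
    _ = ∑' n : ℤ, 4⁻¹ * ∫⁻ h, (4:ℝ≥0∞) ^ n * (∫⁻ x, ‖f (x + (2:ℝ) ^ (-n) • h)
          + f (x - (2:ℝ) ^ (-n) • h) - 2 * f x‖ₑ ^ 2) ∂cubeMeasure := by
        congr 1; ext n
        rw [lintegral_const_mul' _ _ (by simp), lintegral_lintegral_swap (meas n).aemeasurable,
          lintegral_const_mul' _ _ (ENNReal.zpow_ne_top (by norm_num) (by norm_num) n)]
        ring
    _ = 4⁻¹ * ∫⁻ h, ∑' n : ℤ, (4:ℝ≥0∞) ^ n * (∫⁻ x, ‖f (x + (2:ℝ) ^ (-n) • h)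
          + f (x - (2:ℝ) ^ (-n) • h) - 2 * f x‖ₑ ^ 2) ∂cubeMeasure := by
        rw [ENNReal.tsum_mul_left, lintegral_tsum]
        intro n
        exact ((meas n).lintegral_prod_left'.const_mul _).aemeasurable
    _ ≤ 4⁻¹ * ∫⁻ h, 4 * (∫⁻ x, ‖fderiv ℝ f x h‖ₑ ^ 2) ∂cubeMeasure := by
        gcongr with h
        exact tsum_second_difference_le f h
    _ = ∫⁻ x, ∫⁻ h, ‖fderiv ℝ f x h‖ₑ ^ 2 ∂cubeMeasure := by
        rw [lintegral_const_mul' _ _ (by simp), ← mul_assoc,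
          ENNReal.inv_mul_cancel (by simp) (by simp), one_mul]
        exact lintegral_lintegral_swap (f := fun h x => ‖fderiv ℝ f x h‖ₑ ^ 2) hD.aemeasurable
    _ = ∫⁻ x, ENNReal.ofReal (1/12 * ∑ j, (fderiv ℝ f x (Pi.single j 1)) ^ 2) := by
        refine lintegral_congr fun x => ?_
        have hc : Continuous fun h : V3 => ∑ j, h j * fderiv ℝ f x (Pi.single j 1) := by fun_prop
        rw [← integral_sum_mul_sq_cubeMeasure, ← lintegral_enorm_sq_eq]
        · exact lintegral_congr fun h => by rw [dexp x h]
        · exact (memLp_two_iff_integrable_sq hc.aestronglyMeasurable).2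
            (integrable_cubeMeasure (hc.pow 2))
    _ = _ := by
        rw [← integral_const_mul, ofReal_integral_eq_lintegral_ofReal]
        · refine Integrable.const_mul (integrable_finsetSum _ fun j _ => ?_) _
          exact (memLp_lineDeriv f _).integrable_sq
        · exact ae_of_all _ fun x => by positivity

theorem cubeAvg_sq_le (f : 𝓢(V3, ℝ)) (x : V3) {ℓ : ℝ} (hℓ : 0 < ℓ) :
    cubeAvg ℓ f x ^ 2 ≤ (ℓ ^ 3)⁻¹ * ∫ y, f y ^ 2 := by
  have hf : MemLp f 2 := f.memLp 2 volume
  have hc : Continuous fun h : V3 => f (x + ℓ • h) := f.continuous.comp (by fun_prop)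
  have hnn : 0 ≤ (ℓ ^ 3)⁻¹ * ∫ y, f y ^ 2 :=
    mul_nonneg (by positivity) (integral_nonneg fun _ => sq_nonneg _)
  rw [← ENNReal.ofReal_le_ofReal_iff hnn, ENNReal.ofReal_mul (by positivity),
    ← lintegral_enorm_sq_eq hf, ← sq_abs, ENNReal.ofReal_pow (abs_nonneg _),
    ← Real.enorm_eq_ofReal_abs]
  calc ‖cubeAvg ℓ f x‖ₑ ^ 2 ≤ (∫⁻ h, ‖f (x + ℓ • h)‖ₑ ∂cubeMeasure) ^ 2 := by
        gcongr; exact enorm_integral_le_lintegral_enorm _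
    _ ≤ ∫⁻ h, ‖f (x + ℓ • h)‖ₑ ^ 2 ∂cubeMeasure :=
        sq_lintegral_le hc.enorm.measurable.aemeasurable
    _ ≤ ∫⁻ h, ‖f (x + ℓ • h)‖ₑ ^ 2 := lintegral_mono' cubeMeasure_le le_rfl
    _ = ENNReal.ofReal (ℓ ^ 3)⁻¹ * ∫⁻ y, ‖f (x + y)‖ₑ ^ 2 := by
        have hm := Measure.map_addHaar_smul (volume : Measure V3) hℓ.ne'
        have hc' : Continuous fun y : V3 => f (x + y) := f.continuous.comp (by fun_prop)
        rw [← lintegral_map (f := fun y : V3 => ‖f (x + y)‖ₑ ^ 2) (g := fun h => ℓ • h)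
          (hc'.enorm.measurable.pow_const 2) (measurable_const_smul ℓ), hm, lintegral_smul_measure]
        simp [abs_of_pos hℓ]
    _ = ENNReal.ofReal (ℓ ^ 3)⁻¹ * ∫⁻ y, ‖f y‖ₑ ^ 2 := by
        rw [lintegral_add_left_eq_self (fun y => ‖f y‖ₑ ^ 2) x]

theorem sum_cubeAvg_sq_le {ι : Type*} [Fintype ι] (W : ι → 𝓢(V3, ℝ))
    (hW : ∀ c : ι → ℝ, ∫ y, (∑ i, c i * W i y) ^ 2 ≤ ∑ i, c i ^ 2)
    (x : V3) {ℓ : ℝ} (hℓ : 0 < ℓ) :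
    ∑ i, cubeAvg ℓ (W i) x ^ 2 ≤ (ℓ ^ 3)⁻¹ := by
  set S := ∑ i, cubeAvg ℓ (W i) x ^ 2 with hS
  obtain ⟨F, hF⟩ : ∃ F : 𝓢(V3, ℝ), ∀ y, F y = ∑ i, cubeAvg ℓ (W i) x * W i y :=
    ⟨∑ i, cubeAvg ℓ (W i) x • W i, fun y => by simp⟩
  have h1 := cubeAvg_sq_le F x hℓ
  have h2 : cubeAvg ℓ F x = S := by
    rw [cubeAvg]
    simp_rw [hF]
    rw [integral_finsetSum _ fun i _ => (integrable_comp_cube (W i) x ℓ).const_mul _]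
    simp_rw [integral_const_mul, hS, sq]
    rfl
  rw [h2] at h1
  simp_rw [hF] at h1
  have h3 : S ^ 2 ≤ (ℓ ^ 3)⁻¹ * S := h1.trans (by gcongr; exact hW _)
  have h0 : 0 ≤ S := Finset.sum_nonneg fun _ _ => sq_nonneg _
  rcases h0.eq_or_lt with h | h
  · rw [← h]; positivity
  · nlinarith

theorem sqrt_sum_sq_le_add {ι : Type*} (s : Finset ι) (a b : ι → ℝ) :
    √(∑ i ∈ s, a i ^ 2) ≤ √(∑ i ∈ s, b i ^ 2) + √(∑ i ∈ s, (a i - b i) ^ 2) := by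
  have h1 := Real.sum_mul_le_sqrt_mul_sqrt s b (fun i => a i - b i)
  apply Real.sqrt_le_iff.2 ⟨by positivity, ?_⟩
  rw [add_sq, Real.sq_sqrt (by positivity), Real.sq_sqrt (by positivity)]
  have : ∑ i ∈ s, a i ^ 2 = ∑ i ∈ s, b i ^ 2 + 2 * ∑ i ∈ s, b i * (a i - b i)
      + ∑ i ∈ s, (a i - b i) ^ 2 := by
    rw [Finset.mul_sum, ← Finset.sum_add_distrib, ← Finset.sum_add_distrib]
    exact Finset.sum_congr rfl fun i _ => by ring
  rw [this]
  nlinarith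

theorem dyadic_scale_bound {τ r : ℝ} (hτ : 0 ≤ τ) (hr : 0 ≤ r)
    (h : ∀ n : ℤ, √3 * τ ^ 3 ≤ √3 * (√2 ^ n) ^ 3 + √r / (√2 ^ n) ^ 2) :
    0.2352 * τ ^ 10 ≤ r := by
  rcases hτ.eq_or_lt with rfl | hτ
  · simpa using hr
  have s2 : 1 < √2 := by
    rw [Real.lt_sqrt (by norm_num)]; norm_num
  have s2' : √2 < 1.41422 := by
    rw [Real.sqrt_lt' (by norm_num)]; norm_num
  obtain ⟨n, hn1, hn2⟩ := exists_mem_Ico_zpow (x := 0.846 * τ) (y := √2) (by positivity) s2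
  specialize h n
  have hq : 0 < √2 ^ n := by positivity
  rw [zpow_add_one₀ (by positivity)] at hn2
  set q := √2 ^ n with hqdef
  obtain ⟨y, hy⟩ : ∃ y, q = y * τ := ⟨q / τ, by field_simp⟩
  have y2 : y ≤ 0.846 := by
    rw [hy] at hn1; exact le_of_mul_le_mul_right hn1 hτ
  have y1 : 0.598 ≤ y := by
    rw [hy] at hn2
    have h0 : 0.846 < y * √2 := by
      have : 0.846 * τ < (y * √2) * τ := by linarith
      exact lt_of_mul_lt_mul_right this hτ.le
    have : 0 < y := by
      by_contra hc
      nlinarith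
    nlinarith
  have hy0 : 0 < y := by linarith
  have hpoly : 0.28 ≤ y ^ 2 - y ^ 5 := by
    have hp : 0 ≤ (y - 0.598) * (0.846 - y) := mul_nonneg (by linarith) (by linarith)
    nlinarith [mul_nonneg hp (by positivity : 0 ≤ y ^ 3), mul_nonneg hp (by positivity : 0 ≤ y ^ 2),
      mul_nonneg hp hy0.le]
  rw [hy] at h
  have h1 : √3 * τ ^ 5 * (y ^ 2 - y ^ 5) ≤ √r := by
    have := mul_le_mul_of_nonneg_left h (by positivity : 0 ≤ (y * τ) ^ 2)
    have e : (y * τ) ^ 2 * (√3 * (y * τ) ^ 3 + √r / (y * τ) ^ 2)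
        = (y * τ) ^ 2 * (√3 * (y * τ) ^ 3) + √r := by
      field_simp
    rw [e] at this
    nlinarith
  have h2 : √3 * τ ^ 5 * 0.28 ≤ √r := le_trans (by gcongr) h1
  have h3 := pow_le_pow_left₀ (by positivity) h2 2
  rw [Real.sq_sqrt hr, mul_pow, mul_pow, Real.sq_sqrt (by norm_num)] at h3
  nlinarith

theorem lieb_thirring_pointwise {ι : Type*} [Fintype ι] (W : ι → Fin 3 → 𝓢(V3, ℝ))
    (hW : ∀ a, ∀ c : ι → ℝ, ∫ y, (∑ i, c i * W i a y) ^ 2 ≤ ∑ i, c i ^ 2) (x : V3)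
    {τ : ℝ} (hτ : 0 ≤ τ) (hρ : ∑ i, ∑ a, W i a x ^ 2 = 3 * τ ^ 6) :
    ENNReal.ofReal (0.2352 * τ ^ 10) ≤ ∑ i, ∑ a, ∑' n : ℤ,
      (4:ℝ≥0∞) ^ n * ‖W i a x - cubeAvg ((2:ℝ) ^ (-n)) (W i a) x‖ₑ ^ 2 := by
  set R := ∑ i, ∑ a, ∑' n : ℤ,
      (4:ℝ≥0∞) ^ n * ‖W i a x - cubeAvg ((2:ℝ) ^ (-n)) (W i a) x‖ₑ ^ 2 with hR
  by_cases hRt : R = ⊤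
  · rw [hRt]; exact le_top
  apply ENNReal.ofReal_le_of_le_toReal
  refine dyadic_scale_bound hτ ENNReal.toReal_nonneg fun n => ?_
  set ℓ := (2:ℝ) ^ (-n) with hℓ
  have hq : (√2 ^ n) ^ 2 = (2:ℝ) ^ n := by
    rw [← zpow_natCast, ← zpow_mul, mul_comm, zpow_mul]; simp
  have hq0 : 0 < √2 ^ n := by positivity
  have hℓq : (ℓ ^ 3)⁻¹ = ((√2 ^ n) ^ 3) ^ 2 := by
    rw [hℓ, zpow_neg, ← hq]; field_simp
  have hlow : ∑ p : ι × Fin 3, cubeAvg ℓ (W p.1 p.2) x ^ 2 ≤ 3 * ((√2 ^ n) ^ 3) ^ 2 := by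
    rw [Fintype.sum_prod_type_right]
    calc _ ≤ ∑ a : Fin 3, (ℓ ^ 3)⁻¹ := Finset.sum_le_sum fun a _ =>
          sum_cubeAvg_sq_le (fun i => W i a) (hW a) x (by positivity)
      _ = _ := by rw [hℓq]; simp
  have hhigh : (2:ℝ) ^ n * (2:ℝ) ^ n * ∑ p : ι × Fin 3, (W p.1 p.2 x - cubeAvg ℓ (W p.1 p.2) x) ^ 2
      ≤ R.toReal := by
    rw [← ENNReal.ofReal_le_iff_le_toReal hRt, ENNReal.ofReal_mul (by positivity),
      ENNReal.ofReal_sum_of_nonneg fun _ _ => sq_nonneg _, Fintype.sum_prod_type, Finset.mul_sum]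
    simp_rw [Finset.mul_sum]
    refine Finset.sum_le_sum fun i _ => Finset.sum_le_sum fun a _ => ?_
    refine le_trans (le_of_eq ?_) (ENNReal.le_tsum n)
    rw [← sq_abs, ENNReal.ofReal_pow (abs_nonneg _), ← Real.enorm_eq_ofReal_abs,
      ← mul_zpow, show ((2:ℝ) * 2) ^ n = (((4:NNReal) ^ n : NNReal) : ℝ) by push_cast; norm_num,
      ENNReal.ofReal_coe_nnreal, ENNReal.coe_zpow (by norm_num)]
    norm_num [hℓ]
  have hmain := sqrt_sum_sq_le_add Finset.univ (fun p : ι × Fin 3 => W p.1 p.2 x)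
    (fun p => cubeAvg ℓ (W p.1 p.2) x)
  have e0 : √(∑ p : ι × Fin 3, W p.1 p.2 x ^ 2) = √3 * τ ^ 3 := by
    rw [Fintype.sum_prod_type, hρ, Real.sqrt_mul (by norm_num), show τ ^ 6 = (τ ^ 3) ^ 2 by ring,
      Real.sqrt_sq (by positivity)]
  have e1 : √(∑ p : ι × Fin 3, cubeAvg ℓ (W p.1 p.2) x ^ 2) ≤ √3 * (√2 ^ n) ^ 3 := by
    refine (Real.sqrt_le_sqrt hlow).trans (le_of_eq ?_)
    rw [Real.sqrt_mul (by norm_num), Real.sqrt_sq (by positivity)]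
  have e2 : √(∑ p : ι × Fin 3, (W p.1 p.2 x - cubeAvg ℓ (W p.1 p.2) x) ^ 2)
      ≤ √R.toReal / (√2 ^ n) ^ 2 := by
    rw [le_div_iff₀ (by positivity), hq]
    apply Real.le_sqrt_of_sq_le
    rw [mul_pow, Real.sq_sqrt (by positivity)]
    linarith
  linarith

theorem young_three_fifths {V τ c : ℝ} (hV : 0 ≤ V) (hτ : 0 ≤ τ) (hc : 0 < c) :
    V * (3 * τ ^ 6) ≤ 3/5 * c * τ ^ 10
      + 2/5 * (3 ^ (5/2:ℝ) * c ^ (-(3/2):ℝ)) * V ^ (5/2:ℝ) := by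
  have h := Real.young_inequality_of_nonneg (a := c ^ (3/5:ℝ) * τ ^ 6)
    (b := 3 * V * c ^ (-(3/5):ℝ)) (p := 5/3) (q := 5/2) (by positivity) (by positivity)
    ⟨by norm_num, by norm_num, by norm_num⟩
  have e1 : c ^ (3/5:ℝ) * τ ^ 6 * (3 * V * c ^ (-(3/5):ℝ)) = V * (3 * τ ^ 6) := by
    rw [Real.rpow_neg hc.le]; field_simp
  have e2 : (c ^ (3/5:ℝ) * τ ^ 6) ^ (5/3:ℝ) = c * τ ^ 10 := by
    rw [Real.mul_rpow (by positivity) (by positivity), ← Real.rpow_mul hc.le,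
      ← Real.rpow_natCast, ← Real.rpow_mul hτ, ← Real.rpow_natCast]
    norm_num
  have e3 : (3 * V * c ^ (-(3/5):ℝ)) ^ (5/2:ℝ) = 3 ^ (5/2:ℝ) * c ^ (-(3/2):ℝ) * V ^ (5/2:ℝ) := by
    rw [Real.mul_rpow (by positivity) (by positivity), Real.mul_rpow (by positivity) hV,
      ← Real.rpow_mul hc.le]
    norm_num
    ring
  rw [e1, e2, e3] at h
  linarith

theorem lintegral_mul_density_le {ι : Type*} [Fintype ι] (W : ι → Fin 3 → 𝓢(V3, ℝ))
    (hW : ∀ a, ∀ c : ι → ℝ, ∫ y, (∑ i, c i * W i a y) ^ 2 ≤ ∑ i, c i ^ 2)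
    {V : V3 → ℝ} (hV : Continuous V) (hV0 : ∀ x, 0 ≤ V x) {ν : ℝ} (hν : 0 < ν) :
    ∫⁻ x, ENNReal.ofReal (V x * ∑ i, ∑ a, W i a x ^ 2)
      ≤ ENNReal.ofReal (3 * ν / 5 * ∑ i, ∑ a, ∫ x, ∑ j, (fderiv ℝ (W i a) x (Pi.single j 1)) ^ 2)
        + ENNReal.ofReal (2/5 * (3 ^ (5/2:ℝ) * (2.8224 * ν) ^ (-(3/2):ℝ)))
          * ∫⁻ x, ENNReal.ofReal (V x ^ (5/2:ℝ)) := by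
  have hmeas : ∀ i a, ∀ n : ℤ, Measurable fun x =>
      (4:ℝ≥0∞) ^ n * ‖W i a x - cubeAvg ((2:ℝ) ^ (-n)) (W i a) x‖ₑ ^ 2 := fun i a n =>
    (((W i a).continuous.measurable.sub (measurable_cubeAvg (W i a) _)).enorm.pow_const 2).const_mul _
  have hR : ∫⁻ x, ∑ i, ∑ a, ∑' n : ℤ,
      (4:ℝ≥0∞) ^ n * ‖W i a x - cubeAvg ((2:ℝ) ^ (-n)) (W i a) x‖ₑ ^ 2
      ≤ ENNReal.ofReal (1/12 * ∑ i, ∑ a, ∫ x, ∑ j, (fderiv ℝ (W i a) x (Pi.single j 1)) ^ 2) := by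
    rw [lintegral_finsetSum _ fun i _ => Finset.measurable_fun_sum _ fun a _ =>
      Measurable.tsum (hmeas i a)]
    simp_rw [lintegral_finsetSum _ fun a _ => Measurable.tsum (hmeas _ a)]
    have hnn : ∀ i a, 0 ≤ 1/12 * ∫ x, ∑ j, (fderiv ℝ (W i a) x (Pi.single j 1)) ^ 2 := fun i a =>
      mul_nonneg (by norm_num) (integral_nonneg fun _ => by positivity)
    rw [Finset.mul_sum, ENNReal.ofReal_sum_of_nonneg fun i _ => by
      rw [Finset.mul_sum]; exact Finset.sum_nonneg fun a _ => hnn i a]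
    simp_rw [Finset.mul_sum]
    refine Finset.sum_le_sum fun i _ => ?_
    rw [ENNReal.ofReal_sum_of_nonneg fun a _ => hnn i a]
    refine Finset.sum_le_sum fun a _ => ?_
    rw [lintegral_tsum fun n => (hmeas i a n).aemeasurable]
    refine le_trans (le_of_eq ?_) (tsum_sub_cubeAvg_le (W i a))
    congr 1; ext n
    rw [lintegral_const_mul' _ _ (ENNReal.zpow_ne_top (by norm_num) (by norm_num) n)]
  have hpt : ∀ x, ENNReal.ofReal (V x * ∑ i, ∑ a, W i a x ^ 2)
      ≤ ENNReal.ofReal (3/5 * (12 * ν)) * (∑ i, ∑ a, ∑' n : ℤ,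
          (4:ℝ≥0∞) ^ n * ‖W i a x - cubeAvg ((2:ℝ) ^ (-n)) (W i a) x‖ₑ ^ 2)
        + ENNReal.ofReal (2/5 * (3 ^ (5/2:ℝ) * (2.8224 * ν) ^ (-(3/2):ℝ)))
          * ENNReal.ofReal (V x ^ (5/2:ℝ)) := by
    intro x
    set ρ := ∑ i, ∑ a, W i a x ^ 2 with hρ
    have hρ0 : 0 ≤ ρ := Finset.sum_nonneg fun _ _ => Finset.sum_nonneg fun _ _ => sq_nonneg _
    set τ := (ρ / 3) ^ (1/6:ℝ) with hτ
    have hτ0 : 0 ≤ τ := by positivity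
    have hτ6 : ρ = 3 * τ ^ 6 := by
      rw [hτ, ← Real.rpow_natCast, ← Real.rpow_mul (by positivity)]
      norm_num
      ring
    have h1 := lieb_thirring_pointwise W hW x hτ0 hτ6
    have h2 := young_three_fifths (hV0 x) hτ0 (by positivity : 0 < 2.8224 * ν)
    rw [hτ6, ← ENNReal.ofReal_mul (by positivity)]
    refine (ENNReal.ofReal_le_ofReal h2).trans ?_
    rw [ENNReal.ofReal_add (by positivity) (by have := hV0 x; positivity)]
    gcongr
    refine le_trans (le_of_eq ?_) (mul_le_mul_right h1 _)
    rw [← ENNReal.ofReal_mul (by positivity)]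
    congr 1; ring
  refine (lintegral_mono hpt).trans ?_
  rw [lintegral_add_right, lintegral_const_mul' _ _ ENNReal.ofReal_ne_top,
    lintegral_const_mul' _ _ ENNReal.ofReal_ne_top]
  · gcongr
    refine (mul_le_mul_right hR _).trans (le_of_eq ?_)
    rw [← ENNReal.ofReal_mul (by positivity)]
    congr 1; ring
  · exact ((hV.rpow_const fun _ => Or.inr (by norm_num)).measurable.ennreal_ofReal).const_mul _

open Filter Topology in
theorem two_mul_enorm_le_lintegral_deriv {φ φ' : ℝ → ℝ} (hφ : ∀ t, HasDerivAt φ (φ' t) t)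
    (hφ' : Continuous φ') (hb : Tendsto φ atBot (𝓝 0)) (ht : Tendsto φ atTop (𝓝 0)) (a : ℝ) :
    2 * ‖φ a‖ₑ ≤ ∫⁻ t, ‖φ' t‖ₑ := by
  by_cases h : ∫⁻ t, ‖φ' t‖ₑ = ⊤
  · rw [h]; exact le_top
  have h_int : Integrable φ' := ⟨hφ'.aestronglyMeasurable, lt_top_iff_ne_top.2 h⟩
  have h1 := integral_Iic_of_hasDerivAt_of_tendsto' (a := a) (fun t _ => hφ t) h_int.integrableOn hb
  have h2 := integral_Ioi_of_hasDerivAt_of_tendsto' (a := a) (fun t _ => hφ t) h_int.integrableOn ht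
  rw [sub_zero] at h1
  rw [zero_sub] at h2
  calc 2 * ‖φ a‖ₑ = ‖∫ t in Iic a, φ' t‖ₑ + ‖∫ t in Ioi a, φ' t‖ₑ := by
        rw [h1, h2, enorm_neg, two_mul]
    _ ≤ (∫⁻ t in Iic a, ‖φ' t‖ₑ) + ∫⁻ t in Ioi a, ‖φ' t‖ₑ :=
        add_le_add (enorm_integral_le_lintegral_enorm _) (enorm_integral_le_lintegral_enorm _)
    _ = ∫⁻ t, ‖φ' t‖ₑ := by
        rw [← compl_Iic, lintegral_add_compl _ measurableSet_Iic]

theorem enorm_le_lintegral_update (g : 𝓢(V3, ℝ)) {F : V3 → ℝ≥0∞}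
    (hF : ∀ l x, ‖fderiv ℝ g x (Pi.single l 1)‖ₑ ≤ 2 * F x) (l : Fin 3) (x : V3) :
    ‖g x‖ₑ ≤ ∫⁻ t, F (Function.update x l t) := by
  have hc := (Topology.IsClosedEmbedding.tendsto_cocompact (isClosedEmbedding_update x l))
  have hg := g.tendsto_cocompact.comp hc
  rw [_root_.cocompact_eq_atBot_atTop, Filter.tendsto_sup] at hg
  have hd : ∀ t, HasDerivAt (g ∘ Function.update x l)
      (fderiv ℝ g (Function.update x l t) (Pi.single l 1)) t := fun t =>
    g.differentiableAt.hasFDerivAt.comp_hasDerivAt t (hasDerivAt_update x l t)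
  have h := two_mul_enorm_le_lintegral_deriv hd
    ((continuous_lineDeriv g _).comp (continuous_const.update l continuous_id)) hg.1 hg.2 (x l)
  rw [Function.comp_apply, Function.update_eq_self] at h
  have h2 : 2 * ‖g x‖ₑ ≤ 2 * ∫⁻ t, F (Function.update x l t) :=
    h.trans ((lintegral_mono fun t => hF l _).trans
      (le_of_eq (lintegral_const_mul' _ _ (by norm_num))))
  exact (ENNReal.mul_le_mul_iff_right (by norm_num) (by norm_num)).1 h2

theorem lintegral_enorm_rpow_three_halves_le (g : 𝓢(V3, ℝ)) {F : V3 → ℝ≥0∞} (hFm : Measurable F)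
    (hF : ∀ l x, ‖fderiv ℝ g x (Pi.single l 1)‖ₑ ≤ 2 * F x) :
    ∫⁻ x, ‖g x‖ₑ ^ (3/2 : ℝ) ≤ (∫⁻ x, F x) ^ (3/2 : ℝ) := by
  have hp : Real.HolderConjugate (Fintype.card (Fin 3)) (3/2) := by
    rw [Fintype.card_fin]; exact ⟨by norm_num, by norm_num, by norm_num⟩
  refine le_trans ?_ (lintegral_prod_lintegral_pow_le (fun _ => volume) hp hFm)
  refine lintegral_mono fun x => ?_
  calc ‖g x‖ₑ ^ (3/2 : ℝ) = ∏ _l : Fin 3, ‖g x‖ₑ ^ ((1:ℝ) / (Fintype.card (Fin 3) - 1 : ℝ)) := by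
        rw [Finset.prod_const, ← ENNReal.rpow_natCast, ← ENNReal.rpow_mul]
        norm_num
    _ ≤ _ := Finset.prod_le_prod' fun l _ =>
        ENNReal.rpow_le_rpow (enorm_le_lintegral_update g hF l x) (by norm_num)

theorem lintegral_sum_sq_pow_three_le {ι : Type*} [Fintype ι] (f : ι → 𝓢(V3, ℝ)) :
    ∫⁻ x, ENNReal.ofReal ((∑ p, f p x ^ 2) ^ 3)
      ≤ 64 * (∫⁻ x, ENNReal.ofReal (∑ p, ∑ l, (fderiv ℝ (f p) x (Pi.single l 1)) ^ 2)) ^ 3 := by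
  obtain ⟨G, hG⟩ : ∃ G : 𝓢(V3, ℝ), ∀ x, G x = ∑ p, f p x ^ 2 :=
    ⟨∑ p, SchwartzMap.pairing (ContinuousLinearMap.mul ℝ ℝ) (f p) (f p), fun x => by simp [sq]⟩
  obtain ⟨g, hg⟩ : ∃ g : 𝓢(V3, ℝ), ∀ x, g x = G x ^ 2 :=
    ⟨SchwartzMap.pairing (ContinuousLinearMap.mul ℝ ℝ) G G, fun x => by simp [sq]⟩
  obtain ⟨k, hk⟩ : ∃ k : 𝓢(V3, ℝ), ∀ x, k x = G x ^ 3 :=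
    ⟨SchwartzMap.pairing (ContinuousLinearMap.mul ℝ ℝ) G g, fun x => by simp [hg]; ring⟩
  have hG0 : ∀ x, 0 ≤ G x := fun x => by rw [hG]; positivity
  simp_rw [← hG]
  set H : V3 → ℝ := fun x => ∑ p, ∑ l, (fderiv ℝ (f p) x (Pi.single l 1)) ^ 2 with hH
  have hH0 : ∀ x, 0 ≤ H x := fun x => by rw [hH]; positivity
  have hHm : Measurable H := Finset.measurable_fun_sum _ fun p _ =>
    Finset.measurable_fun_sum _ fun l _ => (continuous_lineDeriv (f p) _).measurable.pow_const 2
  set X := ∫⁻ x, ENNReal.ofReal (G x ^ 3) with hX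
  have hXt : X ≠ ⊤ := by
    have := k.integrable (μ := volume).lintegral_lt_top
    simp_rw [hk] at this
    exact this.ne
  set D := ∫⁻ x, ENNReal.ofReal (H x) with hD
  by_cases hDt : D = ⊤
  · rw [hDt]; simp
  have hder : ∀ l x, |fderiv ℝ g x (Pi.single l 1)| ≤ 4 * (√(G x ^ 3) * √(H x)) := by
    intro l x
    have h1 : HasFDerivAt (fun y => (∑ p, f p y ^ 2) ^ 2)
        ((2 * (∑ p, f p x ^ 2)) • ∑ p, (2 * f p x) • fderiv ℝ (f p) x) x := by
      have := (HasFDerivAt.fun_sum (u := Finset.univ) fun p _ =>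
        ((f p).differentiableAt (x := x)).hasFDerivAt.pow 2).pow 2
      simpa using this
    have h2 : (g : V3 → ℝ) = fun y => (∑ p, f p y ^ 2) ^ 2 := by
      ext y; rw [hg, hG]
    rw [h2, h1.fderiv, ← hG]
    have h3 : ((2 * G x) • ∑ p, (2 * f p x) • fderiv ℝ (f p) x) (Pi.single l 1)
        = 4 * G x * ∑ p, f p x * fderiv ℝ (f p) x (Pi.single l 1) := by
      simp [Finset.mul_sum]
      exact Finset.sum_congr rfl fun p _ => by ring
    rw [h3, abs_mul, abs_of_nonneg (by have := hG0 x; positivity)]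
    have h4 : |∑ p, f p x * fderiv ℝ (f p) x (Pi.single l 1)| ≤ √(G x) * √(H x) := by
      rw [← Real.sqrt_mul (hG0 x)]
      apply Real.abs_le_sqrt
      refine (Finset.sum_mul_sq_le_sq_mul_sq _ _ _).trans ?_
      rw [hG]
      refine mul_le_mul_of_nonneg_left (Finset.sum_le_sum fun p _ => ?_) (by positivity)
      exact Finset.single_le_sum (f := fun l => (fderiv ℝ (f p) x (Pi.single l 1)) ^ 2)
        (fun _ _ => sq_nonneg _) (Finset.mem_univ l)
    have h5 : √(G x ^ 3) = G x * √(G x) := by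
      rw [pow_succ, Real.sqrt_mul (by positivity), Real.sqrt_sq (hG0 x)]
    rw [h5]
    nlinarith [mul_le_mul_of_nonneg_left h4 (hG0 x)]
  have hsqrt : ∀ y : ℝ, 0 ≤ y → ENNReal.ofReal √y = ENNReal.ofReal y ^ (1/2 : ℝ) := fun y hy => by
    rw [Real.sqrt_eq_rpow, ENNReal.ofReal_rpow_of_nonneg hy (by norm_num)]
  have hmain := lintegral_enorm_rpow_three_halves_le g
    (F := fun x => 2 * (ENNReal.ofReal (G x ^ 3) ^ (1/2 : ℝ) * ENNReal.ofReal (H x) ^ (1/2 : ℝ)))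
    (by have := G.continuous.measurable; fun_prop) (fun l x => by
      rw [Real.enorm_eq_ofReal_abs]
      refine (ENNReal.ofReal_le_ofReal (hder l x)).trans (le_of_eq ?_)
      rw [ENNReal.ofReal_mul (by norm_num), ENNReal.ofReal_mul (by positivity),
        hsqrt _ (by have := hG0 x; positivity), hsqrt _ (hH0 x), ← mul_assoc 2 2]
      norm_num)
  have e1 : ∀ x, ‖g x‖ₑ ^ (3/2 : ℝ) = ENNReal.ofReal (G x ^ 3) := fun x => by
    rw [hg, Real.enorm_of_nonneg (sq_nonneg _), ENNReal.ofReal_rpow_of_nonneg (sq_nonneg _)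
      (by norm_num), ← Real.rpow_natCast, ← Real.rpow_mul (hG0 x), ← Real.rpow_natCast]
    norm_num
  simp_rw [e1] at hmain
  rw [lintegral_const_mul' _ _ (by norm_num)] at hmain
  have hH2 := ENNReal.lintegral_mul_norm_pow_le (μ := (volume : Measure V3))
    (f := fun x => ENNReal.ofReal (G x ^ 3)) (g := fun x => ENNReal.ofReal (H x))
    (by have := G.continuous.measurable; fun_prop) (by fun_prop) (p := 1/2) (q := 1/2)
    (by norm_num) (by norm_num) (by norm_num)
  have hfin : X ≤ (2 * (X ^ (1/2 : ℝ) * D ^ (1/2 : ℝ))) ^ (3/2 : ℝ) :=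
    hmain.trans (ENNReal.rpow_le_rpow (mul_le_mul_right hH2 2) (by norm_num))
  have h4 : X ^ 4 ≤ X ^ 3 * (64 * D ^ 3) := by
    refine (pow_le_pow_left₀ zero_le hfin 4).trans (le_of_eq ?_)
    rw [← ENNReal.rpow_natCast, ← ENNReal.rpow_mul, ENNReal.mul_rpow_of_nonneg _ _ (by norm_num),
      ENNReal.mul_rpow_of_nonneg _ _ (by norm_num), ← ENNReal.rpow_mul, ← ENNReal.rpow_mul]
    norm_num
    ring
  by_cases hX0 : X = 0
  · rw [hX0]; exact zero_le
  rw [pow_succ] at h4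
  exact (ENNReal.mul_le_mul_iff_right (pow_ne_zero 3 hX0) (ENNReal.pow_ne_top hXt)).1 h4

theorem lintegral_rpow_five_halves_le {V : V3 → ℝ} (hV : Continuous V) (hV0 : ∀ x, 0 ≤ V x) :
    ∫⁻ x, ENNReal.ofReal (V x ^ (5/2 : ℝ))
      ≤ (∫⁻ x, ENNReal.ofReal (V x ^ 2)) ^ (7/8 : ℝ)
        * (∫⁻ x, ENNReal.ofReal ((V x ^ 2) ^ 3)) ^ (1/8 : ℝ) := by
  refine le_trans (le_of_eq (lintegral_congr fun x => ?_)) (ENNReal.lintegral_mul_norm_pow_le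
    (by fun_prop) (by fun_prop) (by norm_num) (by norm_num) (by norm_num))
  have h0 := hV0 x
  rw [ENNReal.ofReal_rpow_of_nonneg (by positivity) (by norm_num),
    ENNReal.ofReal_rpow_of_nonneg (by positivity) (by norm_num),
    ← ENNReal.ofReal_mul (by positivity), ← pow_mul, ← Real.rpow_natCast, ← Real.rpow_natCast,
    ← Real.rpow_mul h0, ← Real.rpow_mul h0, ← Real.rpow_add_of_nonneg h0 (by norm_num) (by norm_num)]
  norm_num

theorem CLT_pow_four_ge : 1.4 ≤ CLT ^ 4 := by
  have g1 : Real.Gamma (7/2) = 15/8 * √Real.pi := by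
    rw [show (7/2:ℝ) = 5/2 + 1 by norm_num, Real.Gamma_add_one (by norm_num),
      show (5/2:ℝ) = 3/2 + 1 by norm_num, Real.Gamma_add_one (by norm_num),
      show (3/2:ℝ) = 1/2 + 1 by norm_num, Real.Gamma_add_one (by norm_num),
      Real.Gamma_one_half_eq]
    ring
  have g2 : Real.Gamma 5 = 24 := by
    rw [show (5:ℝ) = (4:ℕ) + 1 by norm_num, Real.Gamma_nat_eq_factorial]
    norm_num [Nat.factorial]
  have hpi : Real.pi ^ (3/2:ℝ) * √Real.pi = Real.pi ^ 2 := by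
    rw [Real.sqrt_eq_rpow, ← Real.rpow_add Real.pi_pos, ← Real.rpow_natCast]
    norm_num
  have e : 16 * Real.pi ^ ((3:ℝ)/2) * Real.Gamma (7/2) / Real.Gamma 5 = 5 * (Real.pi ^ 2 / 4) := by
    rw [g1, g2, ← hpi]; ring
  have e2 : CLT = 3/5 * (Real.pi ^ 2 / 4) ^ (2/3:ℝ) := by
    rw [CLT, e, Real.mul_rpow (by norm_num) (by positivity),
      show (5:ℝ)/3 = 1 + 2/3 by norm_num, Real.rpow_add (by norm_num), Real.rpow_one]
    have : (0:ℝ) < 5 ^ (2/3:ℝ) := by positivity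
    field_simp
  have h1 : (2.46:ℝ) ≤ Real.pi ^ 2 / 4 := by nlinarith [Real.pi_gt_d4]
  have h2 : (1.82:ℝ) ≤ (Real.pi ^ 2 / 4) ^ (2/3:ℝ) := by
    refine le_trans ?_ (Real.rpow_le_rpow (by norm_num) h1 (by norm_num))
    rw [show (2/3:ℝ) = 2 * 3⁻¹ by norm_num, Real.rpow_mul (by norm_num),
      Real.le_rpow_inv_iff_of_pos (by norm_num) (by positivity) (by norm_num)]
    norm_num
  rw [e2, mul_pow]
  have := pow_le_pow_left₀ (by norm_num) h2 4
  nlinarith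

theorem young_lieb_thirring_const {α ν A D : ℝ} (hα : 0 < α) (hν : 0 < ν) (hA : 0 ≤ A)
    (hD : 0 ≤ D) :
    2/5 * (3 ^ (5/2:ℝ) * (2.8224 * ν) ^ (-(3/2):ℝ)) * (A ^ (7/8:ℝ) * (64 * D ^ 3) ^ (1/8:ℝ))
      ≤ 2 * CLT^4 * ν ^ (-(12:ℝ)/5) * α ^ (-(6:ℝ)/5) * √A ^ ((14:ℝ)/5) + 3/8 * α^2 * D := by
  have key := Real.young_inequality_of_nonneg (a := (α ^ 2 * D) ^ (3/8:ℝ))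
    (b := 2/5 * (3 ^ (5/2:ℝ) * (2.8224 * ν) ^ (-(3/2):ℝ)) * A ^ (7/8:ℝ) * 64 ^ (1/8:ℝ)
      * α ^ (-(3/4):ℝ)) (p := 8/3) (q := 8/5) (by positivity) (by positivity)
    ⟨by norm_num, by norm_num, by norm_num⟩
  have e1 : (α ^ 2 * D) ^ (3/8:ℝ) * (2/5 * (3 ^ (5/2:ℝ) * (2.8224 * ν) ^ (-(3/2):ℝ))
      * A ^ (7/8:ℝ) * 64 ^ (1/8:ℝ) * α ^ (-(3/4):ℝ))
      = 2/5 * (3 ^ (5/2:ℝ) * (2.8224 * ν) ^ (-(3/2):ℝ))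
        * (A ^ (7/8:ℝ) * (64 * D ^ 3) ^ (1/8:ℝ)) := by
    rw [Real.mul_rpow (by positivity) hD, Real.mul_rpow (x := 64) (by norm_num) (by positivity),
      ← Real.rpow_natCast α, ← Real.rpow_natCast D, ← Real.rpow_mul hα.le, ← Real.rpow_mul hD,
      Real.rpow_neg hα.le]
    norm_num
    field_simp
  have e2 : ((α ^ 2 * D) ^ (3/8:ℝ)) ^ (8/3:ℝ) = α ^ 2 * D := by
    rw [← Real.rpow_mul (by positivity)]; norm_num
  have e3 : (2/5 * (3 ^ (5/2:ℝ) * (2.8224 * ν) ^ (-(3/2):ℝ)) * A ^ (7/8:ℝ) * 64 ^ (1/8:ℝ)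
      * α ^ (-(3/4):ℝ)) ^ (8/5:ℝ)
      = ((2/5) ^ (8/5:ℝ) * 3 ^ 4 * 2.8224 ^ (-(12/5):ℝ) * 2 ^ (6/5:ℝ)) *
        (ν ^ (-(12:ℝ)/5) * α ^ (-(6:ℝ)/5) * √A ^ ((14:ℝ)/5)) := by
    have h64 : (64:ℝ) = 2 ^ (6:ℝ) := by norm_num
    have h3 : (3:ℝ) ^ 4 = 3 ^ (4:ℝ) := by norm_num
    rw [Real.mul_rpow (by positivity) (by positivity), Real.mul_rpow (by positivity) (by positivity),
      Real.mul_rpow (by positivity) (by positivity), Real.mul_rpow (by positivity) (by positivity),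
      Real.mul_rpow (by positivity) (by positivity), Real.mul_rpow (by positivity) hν.le,
      Real.mul_rpow (by positivity) (by positivity),
      h64, h3, Real.sqrt_eq_rpow]
    simp only [← Real.rpow_mul hα.le, ← Real.rpow_mul hν.le, ← Real.rpow_mul hA,
      ← Real.rpow_mul (by norm_num : (0:ℝ) ≤ 2), ← Real.rpow_mul (by norm_num : (0:ℝ) ≤ 3),
      ← Real.rpow_mul (by norm_num : (0:ℝ) ≤ 2.8224)]
    norm_num
    ring
  have hc : (5/8) * ((2/5) ^ (8/5:ℝ) * 3 ^ 4 * 2.8224 ^ (-(12/5):ℝ) * 2 ^ (6/5:ℝ)) ≤ 2 * CLT ^ 4 := by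
    have h1 : ((2/5:ℝ)) ^ (8/5:ℝ) * 2.8224 ^ (-(12/5):ℝ) * 2 ^ (6/5:ℝ) ≤ 0.05 := by
      have : ((2/5:ℝ)) ^ (8/5:ℝ) * 2.8224 ^ (-(12/5):ℝ) * 2 ^ (6/5:ℝ)
          = ((2/5) ^ 8 * (2.8224 ^ 12)⁻¹ * 2 ^ 6) ^ (5⁻¹:ℝ) := by
        rw [Real.mul_rpow (by positivity) (by positivity),
          Real.mul_rpow (by positivity) (by positivity), ← Real.rpow_natCast, ← Real.rpow_natCast,
          ← Real.rpow_natCast, ← Real.rpow_neg (by norm_num), ← Real.rpow_mul (by norm_num),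
          ← Real.rpow_mul (by norm_num), ← Real.rpow_mul (by norm_num)]
        norm_num
      rw [this, Real.rpow_inv_le_iff_of_pos (by positivity) (by norm_num) (by norm_num)]
      norm_num
    have h2 := CLT_pow_four_ge
    nlinarith
  rw [e1, e2, e3] at key
  refine key.trans ?_
  have hX : 0 ≤ ν ^ (-(12:ℝ)/5) * α ^ (-(6:ℝ)/5) * √A ^ ((14:ℝ)/5) := by positivity
  nlinarith [mul_le_mul_of_nonneg_right hc hX]

def schwartzComp (g : 𝓢(V3, V3)) (a : Fin 3) : 𝓢(V3, ℝ) :=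
  SchwartzMap.postcompCLM (ContinuousLinearMap.proj (R := ℝ) (φ := fun _ : Fin 3 => ℝ) a) g

@[simp] theorem schwartzComp_apply (g : 𝓢(V3, V3)) (a : Fin 3) (x : V3) :
    schwartzComp g a x = g x a := rfl

theorem fderiv_schwartzComp (g : 𝓢(V3, V3)) (a j : Fin 3) (x : V3) :
    fderiv ℝ (schwartzComp g a) x (Pi.single j 1) = pd j g x a := by
  have h : HasFDerivAt (schwartzComp g a)
      ((ContinuousLinearMap.proj (R := ℝ) (φ := fun _ : Fin 3 => ℝ) a).comp (fderiv ℝ g x)) x :=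
    (ContinuousLinearMap.hasFDerivAt _).comp x (g.differentiableAt (x := x)).hasFDerivAt
  rw [h.fderiv]; rfl

theorem pd_schwartzMap (g : 𝓢(V3, V3)) (j : Fin 3) :
    pd j g = (∂_{(Pi.single j 1 : V3)} g : 𝓢(V3, V3)) := by
  ext x a
  rw [SchwartzMap.lineDerivOp_apply_eq_fderiv]; rfl

theorem integrable_mul_schwartz (f g : 𝓢(V3, ℝ)) : Integrable (fun x => f x * g x) :=
  (SchwartzMap.pairing (ContinuousLinearMap.mul ℝ ℝ) f g).integrable

theorem integrable_fderiv_mul_fderiv (f g : 𝓢(V3, ℝ)) (v : V3) :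
    Integrable (fun x => fderiv ℝ f x v * fderiv ℝ g x v) :=
  (memLp_lineDeriv f v).integrable_mul (memLp_lineDeriv g v)

theorem H1sq_eq_sum (g : 𝓢(V3, V3)) :
    H1sq g = ∑ a, ∫ x, ∑ j, (fderiv ℝ (schwartzComp g a) x (Pi.single j 1)) ^ 2 := by
  rw [← integral_finsetSum]
  · simp_rw [fderiv_schwartzComp]; rfl
  · intro a _
    exact integrable_finsetSum _ fun j _ => (memLp_lineDeriv _ _).integrable_sq

theorem innerA_schwartz (α : ℝ) (v w : 𝓢(V3, V3)) :
    innerA α v w = ∑ a, ((∫ x, schwartzComp v a x * schwartzComp w a x) + α ^ 2 *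
      ∑ j, ∫ x, fderiv ℝ (schwartzComp v a) x (Pi.single j 1)
        * fderiv ℝ (schwartzComp w a) x (Pi.single j 1)) := by
  rw [Finset.sum_add_distrib, ← Finset.mul_sum, innerA,
    ← integral_finsetSum _ fun a _ => integrable_mul_schwartz _ _]
  simp_rw [← integral_finsetSum _ fun j _ => integrable_fderiv_mul_fderiv _ _ _]
  rw [← integral_finsetSum _ fun a _ => integrable_finsetSum _ fun j _ =>
    integrable_fderiv_mul_fderiv _ _ _]
  simp_rw [fderiv_schwartzComp]
  rfl

theorem integral_sum_mul_sq {ι : Type*} [Fintype ι] (f : ι → V3 → ℝ)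
    (hf : ∀ i j, Integrable (fun x => f i x * f j x)) (c : ι → ℝ) :
    ∫ x, (∑ i, c i * f i x) ^ 2 = ∑ i, ∑ j, c i * c j * ∫ x, f i x * f j x := by
  simp_rw [← integral_const_mul]
  simp_rw [← integral_finsetSum _ fun j _ => (hf _ j).const_mul _]
  rw [← integral_finsetSum _ fun i _ => integrable_finsetSum _ fun j _ => (hf i j).const_mul _]
  congr 1; ext x
  rw [sq, Finset.sum_mul_sum]
  exact Finset.sum_congr rfl fun i _ => Finset.sum_congr rfl fun j _ => by ring

theorem integral_sum_mul_sq_le_of_orthonormal {ι : Type*} [Fintype ι] [DecidableEq ι] {α : ℝ}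
    (w : ι → 𝓢(V3, V3)) (h : ∀ i j, innerA α (w i) (w j) = if i = j then 1 else 0)
    (a : Fin 3) (c : ι → ℝ) :
    ∫ y, (∑ i, c i * schwartzComp (w i) a y) ^ 2 ≤ ∑ i, c i ^ 2 := by
  have h1 : ∑ i, c i ^ 2 = ∑ i, ∑ j, c i * c j * innerA α (w i) (w j) := by
    simp [h, sq]
  have h2 : ∑ i, ∑ j, c i * c j * innerA α (w i) (w j)
      = ∑ b, ((∫ y, (∑ i, c i * schwartzComp (w i) b y) ^ 2) + α ^ 2 *
        ∑ l, ∫ y, (∑ i, c i * fderiv ℝ (schwartzComp (w i) b) y (Pi.single l 1)) ^ 2) := by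
    simp_rw [integral_sum_mul_sq _ fun i j => integrable_mul_schwartz (schwartzComp (w i) _)
      (schwartzComp (w j) _),
      integral_sum_mul_sq (fun i y => fderiv ℝ (schwartzComp (w i) _) y (Pi.single _ 1)) fun i j =>
      integrable_fderiv_mul_fderiv (schwartzComp (w i) _) (schwartzComp (w j) _) _, innerA_schwartz]
    have hcomm : ∀ T : ι → ι → Fin 3 → ℝ, ∑ i, ∑ j, ∑ b, T i j b = ∑ b, ∑ i, ∑ j, T i j b :=
      fun T => (Finset.sum_congr rfl fun i _ => Finset.sum_comm).trans Finset.sum_comm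
    simp_rw [Finset.mul_sum, mul_add, Finset.mul_sum, Finset.sum_add_distrib, hcomm]
    congr 1
    refine Finset.sum_congr rfl fun b _ => ?_
    exact Finset.sum_congr rfl fun l _ => Finset.sum_congr rfl fun i _ =>
      Finset.sum_congr rfl fun j _ => by ring
  rw [h1, h2]
  have hnn : ∀ b, 0 ≤ α ^ 2 *
        ∑ l, ∫ y, (∑ i, c i * fderiv ℝ (schwartzComp (w i) b) y (Pi.single l 1)) ^ 2 := fun b =>
    mul_nonneg (sq_nonneg _) (Finset.sum_nonneg fun l _ => integral_nonneg fun y => sq_nonneg _)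
  refine le_trans (le_add_of_nonneg_right (hnn a)) (Finset.single_le_sum (f := fun b =>
    (∫ y, (∑ i, c i * schwartzComp (w i) b y) ^ 2) + α ^ 2 *
        ∑ l, ∫ y, (∑ i, c i * fderiv ℝ (schwartzComp (w i) b) y (Pi.single l 1)) ^ 2)
    (fun b _ => add_nonneg (integral_nonneg fun y => sq_nonneg _) (hnn b)) (Finset.mem_univ a))

theorem abs_trilinear_le (w : V3) (M : Fin 3 → Fin 3 → ℝ) :
    |∑ k, (∑ j, w j * M j k) * w k| ≤ √(∑ k, ∑ j, M j k ^ 2) * ∑ a, w a ^ 2 := by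
  set s := ∑ a, w a ^ 2 with hs
  have hs0 : 0 ≤ s := Finset.sum_nonneg fun _ _ => sq_nonneg _
  have h1 : (∑ k, (∑ j, w j * M j k) * w k) ^ 2 ≤ (∑ k, ∑ j, M j k ^ 2) * s ^ 2 := by
    refine (Finset.sum_mul_sq_le_sq_mul_sq _ _ _).trans ?_
    rw [sq s, ← mul_assoc]
    refine mul_le_mul_of_nonneg_right ?_ hs0
    rw [Finset.sum_mul]
    refine Finset.sum_le_sum fun k _ => ?_
    rw [mul_comm]
    exact Finset.sum_mul_sq_le_sq_mul_sq _ _ _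
  have := Real.abs_le_sqrt h1
  rwa [Real.sqrt_mul (by positivity), Real.sqrt_sq hs0] at this

theorem continuous_frobenius_pd (u : 𝓢(V3, V3)) :
    Continuous fun x => √(∑ k, ∑ j, pd j u x k ^ 2) := by
  simp_rw [← fderiv_schwartzComp]
  have := fun k j => continuous_lineDeriv (schwartzComp u k) (Pi.single j 1)
  fun_prop

theorem ofReal_abs_sum_trilinear_le {ι : Type*} [Fintype ι] (u : 𝓢(V3, V3)) (w : ι → 𝓢(V3, V3)) :
    ENNReal.ofReal |∑ i, ∫ x : V3, ∑ k, (∑ j, w i x j * pd j u x k) * w i x k|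
      ≤ ∫⁻ x, ENNReal.ofReal (√(∑ k, ∑ j, pd j u x k ^ 2)
        * ∑ i, ∑ a, schwartzComp (w i) a x ^ 2) := by
  have hV := continuous_frobenius_pd u
  have hw : ∀ i, Continuous fun x => ∑ a, schwartzComp (w i) a x ^ 2 := fun i =>
    continuous_finsetSum _ fun a _ => (schwartzComp (w i) a).continuous.pow 2
  rw [← Real.enorm_eq_ofReal_abs]
  calc ‖∑ i, ∫ x : V3, ∑ k, (∑ j, w i x j * pd j u x k) * w i x k‖ₑ
      ≤ ∑ i, ‖∫ x : V3, ∑ k, (∑ j, w i x j * pd j u x k) * w i x k‖ₑ := enorm_sum_le _ _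
    _ ≤ ∑ i, ∫⁻ x, ENNReal.ofReal (√(∑ k, ∑ j, pd j u x k ^ 2)
        * ∑ a, schwartzComp (w i) a x ^ 2) := by
      refine Finset.sum_le_sum fun i _ => (enorm_integral_le_lintegral_enorm _).trans
        (lintegral_mono fun x => ?_)
      rw [Real.enorm_eq_ofReal_abs]
      exact ENNReal.ofReal_le_ofReal (abs_trilinear_le (w i x) fun j k => pd j u x k)
    _ = _ := by
      rw [← lintegral_finsetSum _ fun i _ => (hV.fun_mul (hw i)).measurable.ennreal_ofReal]
      refine lintegral_congr fun x => ?_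
      rw [Finset.mul_sum, ENNReal.ofReal_sum_of_nonneg fun i _ => by positivity]

theorem lintegral_frobenius_pow_five_halves_le (u : 𝓢(V3, V3)) :
    ∫⁻ x, ENNReal.ofReal (√(∑ k, ∑ j, pd j u x k ^ 2) ^ (5/2 : ℝ))
      ≤ ENNReal.ofReal (H1sq u ^ (7/8:ℝ) * (64 * H2sq u ^ 3) ^ (1/8:ℝ)) := by
  have hV := continuous_frobenius_pd u
  have hA0 : 0 ≤ H1sq u := integral_nonneg fun x => by positivity
  have hD0 : 0 ≤ H2sq u := integral_nonneg fun x => by positivity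
  have hsq : ∀ x, √(∑ k, ∑ j, pd j u x k ^ 2) ^ 2 = ∑ k, ∑ j, pd j u x k ^ 2 := fun x =>
    Real.sq_sqrt (by positivity)
  have hA : ∫⁻ x, ENNReal.ofReal (√(∑ k, ∑ j, pd j u x k ^ 2) ^ 2) = ENNReal.ofReal (H1sq u) := by
    simp_rw [hsq]
    rw [H1sq, ofReal_integral_eq_lintegral_ofReal _ (ae_of_all _ fun x => by positivity)]
    simp_rw [← fderiv_schwartzComp]
    exact integrable_finsetSum _ fun k _ => integrable_finsetSum _ fun j _ =>
      (memLp_lineDeriv _ _).integrable_sq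
  set f : Fin 3 × Fin 3 → 𝓢(V3, ℝ) := fun p =>
    schwartzComp (∂_{(Pi.single p.2 1 : V3)} u) p.1 with hf
  have hfx : ∀ x, ∑ p, f p x ^ 2 = √(∑ k, ∑ j, pd j u x k ^ 2) ^ 2 := fun x => by
    rw [hsq, Fintype.sum_prod_type]
    simp_rw [hf, schwartzComp_apply, pd_schwartzMap]
  have hD : ∫⁻ x, ENNReal.ofReal (∑ p, ∑ l, (fderiv ℝ (f p) x (Pi.single l 1)) ^ 2)
      = ENNReal.ofReal (H2sq u) := by
    rw [← ofReal_integral_eq_lintegral_ofReal _ (ae_of_all _ fun x => by positivity)]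
    · simp_rw [hf, fderiv_schwartzComp, Fintype.sum_prod_type, ← pd_schwartzMap]
      rfl
    · exact integrable_finsetSum _ fun p _ => integrable_finsetSum _ fun l _ =>
        (memLp_lineDeriv _ _).integrable_sq
  have h6 := lintegral_sum_sq_pow_three_le f
  rw [hD, ← ENNReal.ofReal_pow hD0, show (64 : ℝ≥0∞) = ENNReal.ofReal 64 by norm_num,
    ← ENNReal.ofReal_mul (by norm_num)] at h6
  simp_rw [hfx] at h6
  refine (lintegral_rpow_five_halves_le hV fun x => Real.sqrt_nonneg _).trans ?_
  rw [hA, ENNReal.ofReal_mul (by positivity), ← ENNReal.ofReal_rpow_of_nonneg hA0 (by norm_num),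
    ← ENNReal.ofReal_rpow_of_nonneg (by positivity) (by norm_num)]
  gcongr

theorem abs_sum_trilinear_le {ι : Type*} [Fintype ι] [DecidableEq ι] {α ν : ℝ} (hα : 0 < α)
    (hν : 0 < ν) (u : 𝓢(V3, V3)) (w : ι → 𝓢(V3, V3))
    (h : ∀ i j, innerA α (w i) (w j) = if i = j then 1 else 0) :
    |∑ i, ∫ x : V3, ∑ k, (∑ j, w i x j * pd j u x k) * w i x k|
      ≤ 2 * CLT^4 * ν ^ (-(12:ℝ)/5) * α ^ (-(6:ℝ)/5) * √(H1sq u) ^ ((14:ℝ)/5)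
        + 3/8 * α^2 * H2sq u + 3 * ν / 5 * ∑ i, H1sq (w i) := by
  have hV := continuous_frobenius_pd u
  have hA0 : 0 ≤ H1sq u := integral_nonneg fun x => by positivity
  have hD0 : 0 ≤ H2sq u := integral_nonneg fun x => by positivity
  have hT0 : 0 ≤ ∑ i, H1sq (w i) := Finset.sum_nonneg fun i _ =>
    integral_nonneg fun x => by positivity
  have h1 := (ofReal_abs_sum_trilinear_le u w).trans (lintegral_mul_density_le
    (fun i a => schwartzComp (w i) a) (integral_sum_mul_sq_le_of_orthonormal w h) hV
    (fun x => Real.sqrt_nonneg _) hν)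
  simp_rw [← H1sq_eq_sum] at h1
  have h2 := h1.trans (add_le_add_right (mul_le_mul_right
    (lintegral_frobenius_pow_five_halves_le u) _) _)
  have h3 := young_lieb_thirring_const hα hν hA0 hD0
  generalize H1sq u = A at *
  generalize H2sq u = D at *
  generalize ∑ i, H1sq (w i) = T at *
  rw [← ENNReal.ofReal_mul (by positivity), ← ENNReal.ofReal_add (by positivity) (by positivity),
    ENNReal.ofReal_le_ofReal_iff (by positivity)] at h2
  linarith

end

/-- Lieb–Thirring-type bound on the trilinear term over an `[·,·]_α`-orthonormal family. -/
theorem lieb_thirring_trilinear_bound (α β ν : ℝ) (hα : 0 < α) (hβ : 0 < β) (hν : 0 < ν)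
    (m : ℕ) (hm : 1 ≤ m)
    (u : V3 → Fin 3 → ℝ) (hu : IsSchwartz u) (hudiv : ∀ x, (∑ j, pd j u x j) = 0)
    (w : Fin m → V3 → Fin 3 → ℝ)
    (hw : ∀ i, IsSchwartz (w i)) (hwdiv : ∀ i x, (∑ j, pd j (w i) x j) = 0)
    (horth : ∀ i j, innerA α (w i) (w j) = if i = j then 1 else 0) :
    |∑ i, ∫ x : V3, ∑ k, (∑ j, w i x j * pd j u x k) * w i x k|
      ≤ 2 * CLT^4 * ν ^ (-(12:ℝ)/5) * α ^ (-(6:ℝ)/5)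
          * Real.sqrt (H1sq u) ^ ((14:ℝ)/5)
        + 3/8 * α^2 * H2sq u
        + 3 * ν / 5 * ∑ i, H1sq (w i) :=
  abs_sum_trilinear_le hα hν ⟨u, hu.1, hu.2⟩ (fun i => ⟨w i, (hw i).1, (hw i).2⟩) horth

end
end
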